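/- For every integer k ≥ 2 and every n ∈ ℕ^ℕ, the set of non-trivial extreme points of DF(n) satisfies FE(n) ⊆ E(n) ⊆ FE(n) ∪ Ext(Φ^{-1}(n)), where Ext(Φ^{-1}(n)) denotes the set of extreme points of Φ^{-1}(n). -/

import Mathlib

open Filter Topology
open scoped Classical

namespace BetaDF

/-- Digit sequences (elements of `Σ = {0,…,k−1}^ℕ` when all entries are `< k`). -/
abbrev Seq : Type := ℕ → ℕ

/-- Lexicographic (strict) order on digit sequences. -/
def seqLt (v w : Seq) : Prop := ∃ r, (∀ s, s < r → v s = w s) ∧ v r < w r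

/-- Lexicographic order on digit sequences. -/
def seqLe (v w : Seq) : Prop := seqLt v w ∨ v = w

/-- The shift map `σ`. -/
def shift (w : Seq) : Seq := fun r => w (r + 1)

/-- Membership in `Σ = {0,…,k−1}^ℕ`. -/
def InSigma (k : ℕ) (w : Seq) : Prop := ∀ r, w r < k

/-- A sequence is maximal if it is `≥` every element of its shift orbit. -/
def IsMaximal (w : Seq) : Prop := ∀ r, seqLe (shift^[r] w) w

/-- Number of occurrences of the digit `i` among the first `r` entries of `w`. -/
def digitCount (w : Seq) (i r : ℕ) : ℕ := ((Finset.range r).filter fun s => w s = i).card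

/-- The ambient Euclidean space `ℝ^k`. -/
abbrev E (k : ℕ) : Type := EuclideanSpace ℝ (Fin k)

/-- The `i`-th coordinate (with junk value `0` for `i ≥ k`). -/
def proj {k : ℕ} (α : E k) (i : ℕ) : ℝ := if h : i < k then α ⟨i, h⟩ else 0

/-- `w` has digit frequency vector `α`. -/
def HasDigitFreq (k : ℕ) (w : Seq) (α : E k) : Prop :=
  ∀ i, i < k →
    Tendsto (fun r => (digitCount w i r : ℝ) / (r : ℝ)) atTop (𝓝 (proj α i))

/-- The standard `(k−1)`-simplex `Δ`. -/
def simplex (k : ℕ) : Set (E k) := {α | (∀ i : Fin k, 0 ≤ α i) ∧ ∑ i, α i = 1}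

/-- The face `F = {α ∈ Δ : α_{k−1} = 0}`. -/
def faceF (k : ℕ) : Set (E k) := {α ∈ simplex k | proj α (k - 1) = 0}

/-- `Δ' = Δ ∖ F`. -/
def simplex' (k : ℕ) : Set (E k) := simplex k \ faceF k

/-- `J(α) = ⌊α₀/α_{k−1}⌋`. -/
noncomputable def Jfun {k : ℕ} (α : E k) : ℕ := ⌊proj α 0 / proj α (k - 1)⌋₊

/-- The map `K_n`. -/
noncomputable def Kmap {k : ℕ} (n : ℕ) (α : E k) : E k :=
  (WithLp.equiv 2 (Fin k → ℝ)).symm fun i =>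
    if (i : ℕ) + 2 < k then proj α ((i : ℕ) + 1) / (1 - proj α 0)
    else if (i : ℕ) + 2 = k then (proj α 0 - n * proj α (k - 1)) / (1 - proj α 0)
    else ((n + 1) * proj α (k - 1) - proj α 0) / (1 - proj α 0)

/-- The continued-fraction map `K : Δ' → Δ'`, `K(α) = K_{J(α)}(α)`. -/
noncomputable def Kstep {k : ℕ} (α : E k) : E k := Kmap (Jfun α) α

/-- The itinerary map `Φ(α)_r = J(K^r(α))`. -/
noncomputable def Phi {k : ℕ} (α : E k) : ℕ → ℕ := fun r => Jfun (Kstep^[r] α)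

/-- The projective embedding `K_n^{-1} : Δ → Δ`. -/
noncomputable def Kinv {k : ℕ} (n : ℕ) (α : E k) : E k :=
  (WithLp.equiv 2 (Fin k → ℝ)).symm fun i =>
    (if (i : ℕ) = 0 then (n + 1) * proj α (k - 2) + n * proj α (k - 1)
      else if (i : ℕ) + 1 = k then proj α (k - 2) + proj α (k - 1)
      else proj α ((i : ℕ) - 1)) /
      ((n + 1) * proj α (k - 2) + n * proj α (k - 1) + 1)

/-- `Υ_{n,r} = K_{n₀}^{-1} ∘ ⋯ ∘ K_{n_r}^{-1}`. -/
noncomputable def Ups {k : ℕ} (n : ℕ → ℕ) : ℕ → E k → E k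
  | 0 => Kinv (n 0)
  | r + 1 => fun α => Ups n r (Kinv (n (r + 1)) α)

/-- `A_{n,r} = Υ_{n,r}(Δ)`. -/
noncomputable def Anr (k : ℕ) (n : ℕ → ℕ) (r : ℕ) : Set (E k) := Ups n r '' simplex k

/-- `F_{n,r} = Υ_{n,r}(F)`. -/
noncomputable def Fnr (k : ℕ) (n : ℕ → ℕ) (r : ℕ) : Set (E k) := Ups n r '' faceF k

/-- Reverse-lexicographic strict order on `ℕ^ℕ`: `a < b` iff `a` exceeds `b`
at the first index where they differ. -/
def revLexLt (a b : ℕ → ℕ) : Prop := ∃ r, (∀ s, s < r → a s = b s) ∧ b r < a r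

/-- The word to which the substitution `Λ_n` sends the digit `i`. -/
def lamWord (k n i : ℕ) : List ℕ :=
  if i + 2 < k then [i + 1]
  else if i + 2 = k then (k - 1) :: List.replicate (n + 1) 0
  else (k - 1) :: List.replicate n 0

/-- The substitution `Λ_n : Σ → Σ`. -/
def lamSub (k n : ℕ) (w : Seq) : Seq := fun m =>
  (((List.range (m + 1)).map fun r => lamWord k n (w r)).flatten).getD m 0

/-- `Λ_{n,r} = Λ_{n₀} ∘ ⋯ ∘ Λ_{n_r}`. -/
def lamChain (k : ℕ) (n : ℕ → ℕ) : ℕ → Seq → Seq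
  | 0 => lamSub k (n 0)
  | r + 1 => fun w => lamChain k n r (lamSub k (n (r + 1)) w)

/-- `Λ_{n₀} ∘ ⋯ ∘ Λ_{n_{R−1}}` for a finite list of indices. -/
def lamList (k : ℕ) : List ℕ → Seq → Seq
  | [], w => w
  | a :: t, w => lamSub k a (lamList k t w)

/-- The constant sequence `(k−1)(k−1)(k−1)…`. -/
def topSeq (k : ℕ) : Seq := fun _ => k - 1

/-- The sequence `(k−1)000…`. -/
def baseSeq (k : ℕ) : Seq := fun m => if m = 0 then k - 1 else 0

/-- `S(n) = lim_{r→∞} Λ_{n,r}((k−1)(k−1)(k−1)…)` (limit in the product topology). -/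
noncomputable def Sseq (k : ℕ) (n : ℕ → ℕ) : Seq :=
  limUnder atTop fun r => lamChain k n r (topSeq k)

/-- The compactified itinerary space `N`: sequences with values in `ℕ∞` such that
all entries from the first `∞` onwards equal `∞`.  Elements with no `∞` entry
correspond to `ℕ^ℕ`; the others are the finite type elements `n₀…n_{R−1}∞`. -/
def NN : Type := {m : ℕ → ℕ∞ // ∀ r, m r = ⊤ → m (r + 1) = ⊤}

/-- Reverse-lexicographic strict order on `N` (`∞` counts as larger than every natural). -/
def nnLt (m n : NN) : Prop := ∃ r, (∀ s, s < r → m.1 s = n.1 s) ∧ n.1 r < m.1 r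

/-- Reverse-lexicographic order on `N`. -/
def nnLe (m n : NN) : Prop := nnLt m n ∨ m = n

/-- The element of `N` determined by an element of `ℕ^ℕ`. -/
def toNN (g : ℕ → ℕ) : NN := ⟨fun r => (g r : ℕ∞), fun r h => absurd h (by simp)⟩

/-- The itinerary `n₀ … n_{R−1} (n_R + 1) 0 0 0 …` (of rational type). -/
def ratSeq (f : ℕ → ℕ) (R : ℕ) : ℕ → ℕ := fun r =>
  if r < R then f r else if r = R then f R + 1 else 0

/-- The finite type element `n₀ … n_{R−1} n_R ∞` of `N`. -/
def finNN (f : ℕ → ℕ) (R : ℕ) : NN :=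
  ⟨fun r => if r ≤ R then (f r : ℕ∞) else ⊤, by
    intro r h
    show (if r + 1 ≤ R then ((f (r + 1) : ℕ∞)) else ⊤) = ⊤
    have h' : (if r ≤ R then ((f r : ℕ∞)) else ⊤) = ⊤ := h
    by_cases h1 : r ≤ R
    · rw [if_pos h1] at h'
      exact absurd h' (by simp)
    · rw [if_neg (by omega : ¬ r + 1 ≤ R)]⟩

/-- The extension of `S` to `N`. -/
noncomputable def SN (k : ℕ) (m : NN) : Seq :=
  if h : ∃ R, m.1 R = ⊤ then
    lamList k ((List.range (Nat.find h)).map fun r => (m.1 r).toNat) (baseSeq k)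
  else Sseq k fun r => (m.1 r).toNat

/-- The metric `d(m,n) = 2^{−X(m,n)}` on `N`, where
`X(m,n) = r + min(m₀+⋯+m_r, n₀+⋯+n_r)` and `r` is the first index where `m,n` differ. -/
noncomputable def dN (m n : NN) : ℝ :=
  if h : m = n then 0
  else
    have hex : ∃ r, m.1 r ≠ n.1 r := by
      by_contra hc
      push_neg at hc
      exact h (Subtype.ext (funext hc))
    (2 : ℝ) ^ (-(((Nat.find hex : ℕ) : ℤ) +
      ((min (∑ s ∈ Finset.range (Nat.find hex + 1), m.1 s)
            (∑ s ∈ Finset.range (Nat.find hex + 1), n.1 s)).toNat : ℤ)))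

/-- The symbolic β-shift `X(w)`. -/
def Xset (k : ℕ) (w : Seq) : Set Seq :=
  {v | InSigma k v ∧ ∀ r, seqLe (shift^[r] v) w}

/-- The digit frequency set `DF(w)` of the symbolic β-shift `X(w)`. -/
def DFw (k : ℕ) (w : Seq) : Set (E k) :=
  {α | α ∈ simplex k ∧ ∃ v ∈ Xset k w, HasDigitFreq k v α}

/-- `DF(n) = DF(S(n))` for `n ∈ ℕ^ℕ`. -/
noncomputable def DFn (k : ℕ) (n : ℕ → ℕ) : Set (E k) := DFw k (Sseq k n)

/-- `DF(n) = DF(S(n))` for `n ∈ N`. -/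
noncomputable def DFN (k : ℕ) (m : NN) : Set (E k) := DFw k (SN k m)

/-- The infimax map `I = S ∘ Φ` on `Δ'`, extended by `I(α) = (k−1)000…` on `F`. -/
noncomputable def Ifun (k : ℕ) (α : E k) : Seq :=
  if α ∈ simplex' k then Sseq k (Phi α) else baseSeq k

/-- The simplex `T_m = {α ∈ Δ : (m+1)α_{k−1} ≤ α₀}`. -/
def Tset (k m : ℕ) : Set (E k) :=
  {α ∈ simplex k | ((m : ℝ) + 1) * proj α (k - 1) ≤ proj α 0}

/-- The standard basis vector `e_i`. -/
noncomputable def evec (k i : ℕ) : E k :=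
  (WithLp.equiv 2 (Fin k → ℝ)).symm fun j => if (j : ℕ) = i then 1 else 0

/-- The rational extreme points
`FE(n) = {Υ_{n,s}(e_{k−2}) : n_{s+t} ≠ 0 for some 1 ≤ t ≤ k−2}`. -/
noncomputable def FEset (k : ℕ) (n : ℕ → ℕ) : Set (E k) :=
  {α | ∃ s, (∃ t, 1 ≤ t ∧ t ≤ k - 2 ∧ n (s + t) ≠ 0) ∧ α = Ups n s (evec k (k - 2))}

/-- The set `E(n)` of non-trivial extreme points of `DF(n)`:
extreme points other than `e₀,…,e_{k−2}`. -/
noncomputable def Eset (k : ℕ) (n : ℕ → ℕ) : Set (E k) :=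
  Set.extremePoints ℝ (DFn k n) \ {α | ∃ i, i ≤ k - 2 ∧ α = evec k i}

/-- The fiber `Φ^{-1}(n) ⊆ Δ'`. -/
noncomputable def PhiFiber (k : ℕ) (n : ℕ → ℕ) : Set (E k) :=
  {α ∈ simplex' k | Phi α = n}

/-- `f_β(x) = βx mod 1`. -/
noncomputable def fbeta (β x : ℝ) : ℝ := Int.fract (β * x)

/-- The digit sequence of the greedy β-expansion of `x`: `d_β(x)_r = ⌊β f_β^r(x)⌋`. -/
noncomputable def dbeta (β : ℝ) (x : ℝ) : Seq := fun r => ⌊β * (fbeta β)^[r] x⌋₊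

/-- The digit frequency set `DF(β)` of β-expansions of points of `[0,1]`. -/
noncomputable def DFbeta (k : ℕ) (β : ℝ) : Set (E k) :=
  {α | α ∈ simplex k ∧ ∃ x ∈ Set.Icc (0 : ℝ) 1, HasDigitFreq k (dbeta β x) α}

/-- The sequence `w_β`: if `d_β(1) = d₁…d_{r−1}d_r000…` with `d_r > 0` then `w_β`
is the infinite repetition of `d₁…d_{r−1}(d_r − 1)`; otherwise `w_β = d_β(1)`. -/
noncomputable def wbeta (β : ℝ) : Seq :=
  if h : ∃ r, dbeta β 1 r ≠ 0 ∧ ∀ s, r < s → dbeta β 1 s = 0 then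
    fun m =>
      if m % (Nat.find h + 1) = Nat.find h then dbeta β 1 (Nat.find h) - 1
      else dbeta β 1 (m % (Nat.find h + 1))
  else dbeta β 1

/-- `DF` extended to `[k−1,k]` by `DF(k−1) = F` and `DF(k) = Δ`. -/
noncomputable def DFext (k : ℕ) (β : ℝ) : Set (E k) :=
  if β ≤ (k : ℝ) - 1 then faceF k
  else if (k : ℝ) ≤ β then simplex k
  else DFbeta k β

/-- The mode-locking interval `I_{n₀…n_R}` determined by the word `f 0, …, f R`. -/
noncomputable def Iint (k : ℕ) (f : ℕ → ℕ) (R : ℕ) : Set ℝ :=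
  {β | (k : ℝ) - 1 < β ∧ β < k ∧
    seqLe (Sseq k (ratSeq f R)) (wbeta β) ∧ seqLe (wbeta β) (SN k (finNN f R))}

/-- The frequency vector of the first `s` digits of `w`. -/
noncomputable def freqVec (k : ℕ) (w : Seq) (s : ℕ) : E k :=
  (WithLp.equiv 2 (Fin k → ℝ)).symm fun i => (digitCount w (i : ℕ) s : ℝ) / (s : ℝ)


/-! ### Vectors -/

lemma proj_add {k : ℕ} (a b : E k) (i : ℕ) : proj (a + b) i = proj a i + proj b i := by
  unfold proj; split_ifs <;> simp

lemma proj_smul {k : ℕ} (t : ℝ) (b : E k) (i : ℕ) : proj (t • b) i = t * proj b i := by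
  unfold proj; split_ifs <;> simp

lemma proj_zero {k : ℕ} (i : ℕ) : proj (0 : E k) i = 0 := by
  unfold proj; split_ifs <;> simp

lemma proj_ext {k : ℕ} {a b : E k} (h : ∀ i, i < k → proj a i = proj b i) : a = b := by
  ext i
  have := h i i.2
  simpa [proj] using this

lemma proj_mk {k : ℕ} (f : Fin k → ℝ) (i : ℕ) (h : i < k) :
    proj ((WithLp.equiv 2 (Fin k → ℝ)).symm f : E k) i = f ⟨i, h⟩ := by
  simp [proj, h]

lemma proj_fin {k : ℕ} (a : E k) (i : Fin k) : a i = proj a i := by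
  simp [proj]

lemma proj_evec {k : ℕ} (j i : ℕ) (h : i < k) :
    proj (evec k j) i = if i = j then 1 else 0 := by
  unfold evec; rw [proj_mk _ _ h]

/-- linear version of `Kinv`. -/
noncomputable def Mv {k : ℕ} (m : ℕ) (c : E k) : E k :=
  (WithLp.equiv 2 (Fin k → ℝ)).symm fun i =>
    if (i : ℕ) = 0 then ((m : ℝ) + 1) * proj c (k - 2) + m * proj c (k - 1)
      else if (i : ℕ) + 1 = k then proj c (k - 2) + proj c (k - 1)
      else proj c ((i : ℕ) - 1)

/-- linear version of `Kmap`. -/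
noncomputable def Mi {k : ℕ} (m : ℕ) (c : E k) : E k :=
  (WithLp.equiv 2 (Fin k → ℝ)).symm fun i =>
    if (i : ℕ) + 2 < k then proj c ((i : ℕ) + 1)
    else if (i : ℕ) + 2 = k then (proj c 0 - m * proj c (k - 1))
    else (((m : ℝ) + 1) * proj c (k - 1) - proj c 0)

lemma proj_Mv {k : ℕ} (m : ℕ) (c : E k) (i : ℕ) (h : i < k) : proj (Mv m c) i =
    if i = 0 then ((m : ℝ) + 1) * proj c (k - 2) + m * proj c (k - 1)
      else if i + 1 = k then proj c (k - 2) + proj c (k - 1)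
      else proj c (i - 1) := by
  unfold Mv; rw [proj_mk _ _ h]

lemma proj_Mi {k : ℕ} (m : ℕ) (c : E k) (i : ℕ) (h : i < k) : proj (Mi m c) i =
    if i + 2 < k then proj c (i + 1)
    else if i + 2 = k then (proj c 0 - m * proj c (k - 1))
    else (((m : ℝ) + 1) * proj c (k - 1) - proj c 0) := by
  unfold Mi; rw [proj_mk _ _ h]

lemma Mv_add {k : ℕ} (m : ℕ) (a b : E k) : Mv m (a + b) = Mv m a + Mv m b := by
  apply proj_ext; intro i hi
  simp only [proj_add, proj_Mv _ _ _ hi]; split_ifs <;> ring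

lemma Mv_smul {k : ℕ} (m : ℕ) (t : ℝ) (b : E k) : Mv m (t • b) = t • Mv m b := by
  apply proj_ext; intro i hi
  simp only [proj_smul, proj_Mv _ _ _ hi]; split_ifs <;> ring

lemma Mi_add {k : ℕ} (m : ℕ) (a b : E k) : Mi m (a + b) = Mi m a + Mi m b := by
  apply proj_ext; intro i hi
  simp only [proj_add, proj_Mi _ _ _ hi]; split_ifs <;> ring

lemma Mi_smul {k : ℕ} (m : ℕ) (t : ℝ) (b : E k) : Mi m (t • b) = t • Mi m b := by
  apply proj_ext; intro i hi
  simp only [proj_smul, proj_Mi _ _ _ hi]; split_ifs <;> ring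

lemma Mi_Mv {k : ℕ} (hk : 2 ≤ k) (m : ℕ) (c : E k) : Mi m (Mv m c) = c := by
  apply proj_ext; intro i hi
  rw [proj_Mi _ _ _ hi]
  split_ifs with h1 h2
  · rw [proj_Mv _ _ _ (by omega), if_neg (by omega), if_neg (by omega)]; simp
  · rw [proj_Mv _ _ _ (by omega), proj_Mv _ _ _ (by omega), if_pos rfl, if_neg (by omega),
      if_pos (by omega)]
    have : i = k - 2 := by omega
    subst this; ring
  · rw [proj_Mv _ _ _ (by omega), proj_Mv _ _ _ (by omega), if_neg (by omega), if_pos (by omega),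
      if_pos rfl]
    have : i = k - 1 := by omega
    subst this; ring

lemma Mi_last {k : ℕ} (hk : 2 ≤ k) (m : ℕ) (c : E k) :
    proj (Mi m c) (k - 1) = ((m : ℝ) + 1) * proj c (k - 1) - proj c 0 := by
  rw [proj_Mi _ _ (k-1) (by omega), if_neg (by omega), if_neg (by omega)]

lemma Mi_pen {k : ℕ} (hk : 2 ≤ k) (m : ℕ) (c : E k) :
    proj (Mi m c) (k - 2) = proj c 0 - m * proj c (k - 1) := by
  rw [proj_Mi _ _ (k-2) (by omega), if_neg (by omega), if_pos (by omega)]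

lemma Mv_Mi {k : ℕ} (hk : 2 ≤ k) (m : ℕ) (c : E k) : Mv m (Mi m c) = c := by
  apply proj_ext; intro i hi
  rw [proj_Mv _ _ _ hi, Mi_last hk, Mi_pen hk]
  split_ifs with h1 h2
  · subst h1; ring
  · have : i = k - 1 := by omega
    subst this; ring
  · rw [proj_Mi _ _ _ (by omega), if_pos (by omega)]
    congr 1; omega

lemma Mv_last {k : ℕ} (hk : 2 ≤ k) (m : ℕ) (c : E k) :
    proj (Mv m c) (k - 1) = proj c (k - 2) + proj c (k - 1) := by
  rw [proj_Mv _ _ (k-1) (by omega), if_neg (by omega), if_pos (by omega)]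

lemma Mv_zero {k : ℕ} (hk : 2 ≤ k) (m : ℕ) (c : E k) :
    proj (Mv m c) 0 = ((m : ℝ) + 1) * proj c (k - 2) + m * proj c (k - 1) := by
  rw [proj_Mv _ _ 0 (by omega), if_pos rfl]

/-- Sum of coordinates. -/
noncomputable def vsum {k : ℕ} (c : E k) : ℝ := ∑ i ∈ Finset.range k, proj c i

lemma vsum_eq {k : ℕ} (c : E k) : vsum c = ∑ i, c i := by
  unfold vsum
  rw [Finset.sum_range]
  exact Finset.sum_congr rfl fun i _ => (proj_fin c i).symm

lemma vsum_add {k : ℕ} (a b : E k) : vsum (a + b) = vsum a + vsum b := by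
  simp [vsum, proj_add, Finset.sum_add_distrib]

lemma vsum_smul {k : ℕ} (t : ℝ) (b : E k) : vsum (t • b) = t * vsum b := by
  simp [vsum, proj_smul, Finset.mul_sum]

lemma vsum_Mi {k : ℕ} (hk : 2 ≤ k) (m : ℕ) (c : E k) : vsum (Mi m c) = vsum c - proj c 0 := by
  obtain ⟨d, rfl⟩ : ∃ d, k = d + 2 := ⟨k - 2, by omega⟩
  unfold vsum
  rw [Finset.sum_range_succ, Finset.sum_range_succ, Finset.sum_range_succ', Finset.sum_range_succ]
  have h1 : proj (Mi m c) (d + 1) = _ := Mi_last hk m c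
  have h2 : proj (Mi m c) d = _ := Mi_pen hk m c
  rw [h1, h2]
  have : ∑ x ∈ Finset.range d, proj (Mi m c) x = ∑ x ∈ Finset.range d, proj c (x + 1) := by
    apply Finset.sum_congr rfl
    intro x hx
    have := Finset.mem_range.1 hx
    rw [proj_Mi _ _ _ (by omega), if_pos (by omega)]
  rw [this]
  simp only [show d + 2 - 1 = d + 1 by omega]
  ring

lemma vsum_Mv {k : ℕ} (hk : 2 ≤ k) (m : ℕ) (c : E k) :
    vsum (Mv m c) = vsum c + (((m : ℝ) + 1) * proj c (k - 2) + m * proj c (k - 1)) := by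
  have := vsum_Mi hk m (Mv m c)
  rw [Mi_Mv hk, Mv_zero hk] at this
  linarith

def NN0 {k : ℕ} (c : E k) : Prop := ∀ i, i < k → 0 ≤ proj c i

def TT {k : ℕ} (m : ℕ) (c : E k) : Prop := ((m : ℝ) + 1) * proj c (k - 1) ≤ proj c 0

lemma NN0.add {k : ℕ} {a b : E k} (ha : NN0 a) (hb : NN0 b) : NN0 (a + b) := fun i hi => by
  rw [proj_add]; exact add_nonneg (ha i hi) (hb i hi)

lemma NN0.smul {k : ℕ} {a : E k} (ha : NN0 a) {t : ℝ} (ht : 0 ≤ t) : NN0 (t • a) := fun i hi => by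
  rw [proj_smul]; exact mul_nonneg ht (ha i hi)

lemma NN0_Mv {k : ℕ} (hk : 2 ≤ k) (m : ℕ) {a : E k} (ha : NN0 a) : NN0 (Mv m a) := fun i hi => by
  rw [proj_Mv _ _ _ hi]
  have := ha (k-1) (by omega)
  have := ha (k-2) (by omega)
  split_ifs
  · positivity
  · positivity
  · exact ha _ (by omega)

lemma mem_simplex {k : ℕ} (α : E k) : α ∈ simplex k ↔ NN0 α ∧ vsum α = 1 := by
  unfold simplex NN0
  rw [vsum_eq]
  constructor
  · rintro ⟨h, h'⟩
    exact ⟨fun i hi => by rw [← proj_fin α ⟨i, hi⟩]; exact h _, h'⟩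
  · rintro ⟨h, h'⟩
    exact ⟨fun i => by rw [proj_fin]; exact h _ i.2, h'⟩

lemma NN0.eq_zero {k : ℕ} {a : E k} (ha : NN0 a) (h : vsum a = 0) : a = 0 := by
  apply proj_ext
  intro i hi
  rw [proj_zero]
  exact (Finset.sum_eq_zero_iff_of_nonneg (fun i hi => ha i (Finset.mem_range.1 hi))).1 h i
    (Finset.mem_range.2 hi)

lemma NN0.vsum_nonneg {k : ℕ} {a : E k} (ha : NN0 a) : 0 ≤ vsum a :=
  Finset.sum_nonneg fun i hi => ha i (Finset.mem_range.1 hi)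

/-! ### The cones -/

def sh (n : ℕ → ℕ) : ℕ → ℕ := fun r => n (r + 1)

def DD {k : ℕ} : ℕ → (ℕ → ℕ) → E k → Prop
  | 0, _, c => NN0 c
  | R + 1, n, c => NN0 c ∧ (TT (n 0) c ∨ DD R (sh n) (Mi (n 0) c))

def Lo {k : ℕ} : ℕ → (ℕ → ℕ) → E k → Prop
  | 0, n, c => NN0 c ∧ TT (n 0) c
  | R + 1, n, c => NN0 c ∧ (TT (n 0) c ∨ Lo R (sh n) (Mi (n 0) c))

noncomputable def it {k : ℕ} : (ℕ → ℕ) → ℕ → E k → E k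
  | _, 0, c => c
  | n, R + 1, c => it (sh n) R (Mi (n 0) c)

def Fib {k : ℕ} (n : ℕ → ℕ) (c : E k) : Prop := ∀ r, NN0 (it n r c)

def GG {k : ℕ} (n : ℕ → ℕ) (c : E k) : Prop := ∀ R, DD R n c

lemma DD.nn {k : ℕ} {R : ℕ} {n : ℕ → ℕ} {c : E k} (h : DD R n c) : NN0 c := by
  cases R
  · exact h
  · exact h.1

lemma GG.nn {k : ℕ} {n : ℕ → ℕ} {c : E k} (h : GG n c) : NN0 c := h 0

lemma DD_of_TT {k : ℕ} {R : ℕ} {n : ℕ → ℕ} {c : E k} (h : NN0 c) (h' : TT (n 0) c) : DD R n c := by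
  cases R
  · exact h
  · exact ⟨h, Or.inl h'⟩

lemma GG_iff {k : ℕ} {n : ℕ → ℕ} {c : E k} :
    GG n c ↔ NN0 c ∧ (TT (n 0) c ∨ GG (sh n) (Mi (n 0) c)) := by
  constructor
  · intro h
    refine ⟨h 0, ?_⟩
    by_cases ht : TT (n 0) c
    · exact Or.inl ht
    · exact Or.inr fun R => (h (R + 1)).2.resolve_left ht
  · rintro ⟨h, h' | h'⟩ R
    · exact DD_of_TT h h'
    · cases R
      · exact h
      · exact ⟨h, Or.inr (h' _)⟩

lemma GG_Mv {k : ℕ} (hk : 2 ≤ k) {n : ℕ → ℕ} {c : E k} (h : GG (sh n) c) : GG n (Mv (n 0) c) := by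
  rw [GG_iff, Mi_Mv hk]
  exact ⟨NN0_Mv hk _ h.nn, Or.inr h⟩

lemma DD_smul {k : ℕ} (R : ℕ) : ∀ (n : ℕ → ℕ) (c : E k), DD R n c → ∀ t : ℝ, 0 ≤ t →
    DD R n (t • c) := by
  induction R with
  | zero => intro n c h t ht; exact NN0.smul h ht
  | succ R ih =>
    rintro n c ⟨h, h'⟩ t ht
    refine ⟨h.smul ht, ?_⟩
    rcases h' with h' | h'
    · left; unfold TT at *; rw [proj_smul, proj_smul]; nlinarith
    · right; rw [Mi_smul]; exact ih _ _ h' t ht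

lemma Lo_smul {k : ℕ} (R : ℕ) : ∀ (n : ℕ → ℕ) (c : E k), Lo R n c → ∀ t : ℝ, 0 ≤ t →
    Lo R n (t • c) := by
  induction R with
  | zero =>
    rintro n c ⟨h, h'⟩ t ht; refine ⟨NN0.smul h ht, ?_⟩
    unfold TT at *; rw [proj_smul, proj_smul]; nlinarith
  | succ R ih =>
    rintro n c ⟨h, h'⟩ t ht
    refine ⟨h.smul ht, ?_⟩
    rcases h' with h' | h'
    · left; unfold TT at *; rw [proj_smul, proj_smul]; nlinarith
    · right; rw [Mi_smul]; exact ih _ _ h' t ht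

lemma GG_smul {k : ℕ} {n : ℕ → ℕ} {c : E k} (h : GG n c) {t : ℝ} (ht : 0 ≤ t) : GG n (t • c) :=
  fun R => DD_smul R n c (h R) t ht

lemma DD_mixed {k : ℕ} (hk : 2 ≤ k) (R : ℕ) (n : ℕ → ℕ)
    (ih : ∀ a b : E k, DD R (sh n) a → DD R (sh n) b → DD R (sh n) (a + b))
    (c d : E k) (hc : NN0 c) (hd : NN0 d) (hcT : TT (n 0) c) (hdD : DD R (sh n) (Mi (n 0) d)) :
    DD (R + 1) n (c + d) := by
  refine ⟨hc.add hd, ?_⟩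
  by_cases hT : TT (n 0) (c + d)
  · exact Or.inl hT
  right
  unfold TT at hcT hT
  push Not at hT
  rw [proj_add, proj_add] at hT
  set m := n 0
  set x := proj c 0 - ((m : ℝ) + 1) * proj c (k - 1) with hx
  set y := ((m : ℝ) + 1) * proj d (k - 1) - proj d 0 with hy
  have hx0 : 0 ≤ x := by linarith
  have hxy : x < y := by linarith
  have hy0 : 0 < y := by linarith
  set θ := x / y with hθ
  have hθ0 : 0 ≤ θ := by positivity
  have hθ1 : θ < 1 := by rw [hθ, div_lt_one hy0]; exact hxy
  have hθy : θ * y = x := by rw [hθ]; field_simp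
  have e : c + d = (c + θ • d) + (1 - θ) • d := by
    rw [sub_smul, one_smul]; abel
  rw [e, Mi_add]
  apply ih
  · have hn := hc.add (hd.smul hθ0)
    set z := c + θ • d with hz
    have hH : ((m : ℝ) + 1) * proj z (k - 1) = proj z 0 := by
      rw [hz, proj_add, proj_add, proj_smul, proj_smul]
      have : θ * (((m : ℝ) + 1) * proj d (k - 1) - proj d 0) =
        proj c 0 - ((m : ℝ) + 1) * proj c (k - 1) := hθy
      linarith
    have hNN : NN0 (Mi m z) := by
      intro i hi
      rw [proj_Mi _ _ _ hi]
      split_ifs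
      · exact hn _ (by omega)
      · have := hn (k-1) (by omega); linarith
      · linarith
    refine DD_of_TT hNN ?_
    unfold TT
    rw [Mi_last hk]
    have : ((m : ℝ) + 1) * proj z (k - 1) - proj z 0 = 0 := by linarith
    rw [this, mul_zero]
    exact hNN 0 (by omega)
  · rw [Mi_smul]; exact DD_smul _ _ _ hdD _ (by linarith)

lemma DD_add {k : ℕ} (hk : 2 ≤ k) (R : ℕ) : ∀ (n : ℕ → ℕ) (c d : E k), DD R n c → DD R n d →
    DD R n (c + d) := by
  induction R with
  | zero => intro n c d hc hd; exact NN0.add hc hd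
  | succ R ih =>
    rintro n c d ⟨hc, hc'⟩ ⟨hd, hd'⟩
    rcases hc' with hc' | hc' <;> rcases hd' with hd' | hd'
    · refine ⟨hc.add hd, Or.inl ?_⟩
      unfold TT at *; rw [proj_add, proj_add]; linarith
    · exact DD_mixed hk R n (ih _) c d hc hd hc' hd'
    · rw [add_comm c d]; exact DD_mixed hk R n (ih _) d c hd hc hd' hc'
    · refine ⟨hc.add hd, Or.inr ?_⟩
      rw [Mi_add]; exact ih _ _ _ hc' hd'

lemma GG_add {k : ℕ} (hk : 2 ≤ k) {n : ℕ → ℕ} {c d : E k} (h : GG n c) (h' : GG n d) :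
    GG n (c + d) := fun R => DD_add hk R n c d (h R) (h' R)

lemma Fib_sh {k : ℕ} {n : ℕ → ℕ} {c : E k} (h : Fib n c) : Fib (sh n) (Mi (n 0) c) :=
  fun r => h (r + 1)

lemma Fib.nn {k : ℕ} {n : ℕ → ℕ} {c : E k} (h : Fib n c) : NN0 c := h 0

lemma Fib.gg {k : ℕ} {n : ℕ → ℕ} {c : E k} (h : Fib n c) : GG n c := by
  intro R
  induction R generalizing n c with
  | zero => exact h 0
  | succ R ih => exact ⟨h 0, Or.inr (ih (Fib_sh h))⟩

lemma GG_cases {k : ℕ} {n : ℕ → ℕ} {c : E k} (h : GG n c) : (∃ r, Lo r n c) ∨ Fib n c := by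
  by_cases hL : ∃ r, Lo r n c
  · exact Or.inl hL
  right
  intro r
  induction r generalizing n c with
  | zero => exact h.nn
  | succ r ih =>
    have h1 := (GG_iff.1 h)
    have hT : ¬ TT (n 0) c := fun hT => hL ⟨0, h.nn, hT⟩
    exact ih (h1.2.resolve_left hT) fun ⟨r, hr⟩ => hL ⟨r + 1, h.nn, Or.inr hr⟩

lemma Lo_gg {k : ℕ} {n : ℕ → ℕ} {c : E k} {r : ℕ} (h : Lo r n c) : GG n c := by
  induction r generalizing n c with
  | zero => exact GG_iff.2 ⟨h.1, Or.inl h.2⟩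
  | succ r ih =>
    rcases h with ⟨h, h' | h'⟩
    · exact GG_iff.2 ⟨h, Or.inl h'⟩
    · exact GG_iff.2 ⟨h, Or.inr (ih h')⟩

lemma continuous_proj {k : ℕ} (i : ℕ) : Continuous fun c : E k => proj c i := by
  unfold proj
  split_ifs
  · fun_prop
  · exact continuous_const

lemma continuous_Mi {k : ℕ} (m : ℕ) : Continuous (Mi m : E k → E k) := by
  have : IsLinearMap ℝ (Mi m : E k → E k) := ⟨Mi_add m, Mi_smul m⟩
  exact (this.mk' _).continuous_of_finiteDimensional

lemma isClosed_NN0 {k : ℕ} : IsClosed {c : E k | NN0 c} := by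
  unfold NN0
  simp only [Set.ofPred_forall]
  exact isClosed_iInter fun i => isClosed_iInter fun _ =>
    isClosed_le continuous_const (continuous_proj i)

lemma isClosed_DD {k : ℕ} (R : ℕ) : ∀ n, IsClosed {c : E k | DD R n c} := by
  induction R with
  | zero => intro n; exact isClosed_NN0
  | succ R ih =>
    intro n
    refine isClosed_NN0.inter (IsClosed.union ?_ ((ih (sh n)).preimage (continuous_Mi _)))
    exact isClosed_le (continuous_const.mul (continuous_proj _)) (continuous_proj _)

/-! ### Extreme rays -/

def ExtRay {k : ℕ} (n : ℕ → ℕ) (c : E k) : Prop :=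
  GG n c ∧ ∀ a b, GG n a → GG n b → a + b = c → ∃ t : ℝ, a = t • c

noncomputable def MM {k : ℕ} : (ℕ → ℕ) → ℕ → E k → E k
  | n, 0, c => Mv (n 0) c
  | n, s + 1, c => Mv (n 0) (MM (sh n) s c)

lemma NN0_evec {k : ℕ} (j : ℕ) : NN0 (evec k j) := fun i hi => by
  rw [proj_evec _ _ hi]; split_ifs <;> norm_num

lemma vsum_evec {k : ℕ} (j : ℕ) (hj : j < k) : vsum (evec k j) = 1 := by
  unfold vsum
  rw [Finset.sum_congr rfl fun i hi => proj_evec j i (Finset.mem_range.1 hi)]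
  simp [hj]

lemma MM_NN0 {k : ℕ} (hk : 2 ≤ k) {c : E k} (hc : NN0 c) (s : ℕ) : ∀ n, NN0 (MM n s c) := by
  induction s with
  | zero => intro n; exact NN0_Mv hk _ hc
  | succ s ih => intro n; exact NN0_Mv hk _ (ih _)

lemma Mv_evec {k : ℕ} (m i : ℕ) (hi : i + 2 < k) : Mv m (evec k i) = evec k (i + 1) := by
  apply proj_ext; intro j hj
  rw [proj_Mv _ _ _ hj, proj_evec (i + 1) j hj, proj_evec i (k - 2) (by omega),
    proj_evec i (k - 1) (by omega), if_neg (by omega : ¬ k - 2 = i), if_neg (by omega : ¬ k - 1 = i)]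
  by_cases h1 : j = 0
  · rw [if_pos h1, if_neg (by omega)]; ring
  rw [if_neg h1]
  by_cases h2 : j + 1 = k
  · rw [if_pos h2, if_neg (by omega)]; ring
  rw [if_neg h2, proj_evec _ _ (by omega)]
  by_cases h3 : j = i + 1
  · rw [if_pos h3, if_pos (by omega)]
  · rw [if_neg h3, if_neg (by omega)]

lemma proj_Mv_pen {k : ℕ} (hk : 2 ≤ k) (m : ℕ) (j : ℕ) (hj : j < k) :
    proj (Mv m (evec k (k - 2))) j =
      if j = 0 then (m : ℝ) + 1 else if j + 1 = k then 1 else 0 := by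
  rw [proj_Mv _ _ _ hj, proj_evec (k - 2) (k - 2) (by omega), proj_evec (k - 2) (k - 1) (by omega),
    if_pos (rfl : k - 2 = k - 2), if_neg (by omega : ¬ k - 1 = k - 2)]
  split_ifs with h1 h2
  · ring
  · ring
  · rw [proj_evec _ _ (by omega), if_neg (by omega)]

lemma Mv_pen_eq {k : ℕ} (hk : 2 ≤ k) (m : ℕ) :
    Mv m (evec k (k - 2)) = ((m : ℝ) + 1) • evec k 0 + evec k (k - 1) := by
  apply proj_ext; intro j hj
  rw [proj_Mv_pen hk _ _ hj, proj_add, proj_smul, proj_evec _ _ hj, proj_evec _ _ hj]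
  by_cases h1 : j = 0
  · rw [if_pos h1, if_pos h1, if_neg (by omega)]; ring
  · rw [if_neg h1, if_neg h1]
    by_cases h2 : j + 1 = k
    · rw [if_pos h2, if_pos (by omega)]; ring
    · rw [if_neg h2, if_neg (by omega)]; ring

/-- The vector `x e_j + y e_{k-1}`. -/
noncomputable def xy (k : ℕ) (j : ℕ) (x y : ℝ) : E k := x • evec k j + y • evec k (k - 1)

lemma proj_xy {k : ℕ} (j i : ℕ) (x y : ℝ) (hi : i < k) : proj (xy k j x y) i =
    x * (if i = j then 1 else 0) + y * (if i = k - 1 then 1 else 0) := by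
  unfold xy; rw [proj_add, proj_smul, proj_smul, proj_evec _ _ hi, proj_evec _ _ hi]

lemma Mi_xy {k : ℕ} (hk : 2 ≤ k) (j : ℕ) (hj : j + 3 ≤ k) (x y : ℝ) :
    Mi 0 (xy k (j + 1) x y) = xy k j x y := by
  apply proj_ext; intro i hi
  rw [proj_Mi _ _ _ hi, proj_xy _ _ _ _ hi]
  rw [proj_xy _ _ _ _ (by omega : 0 < k), proj_xy _ _ _ _ (by omega : k - 1 < k)]
  rw [if_neg (by omega : ¬ 0 = j + 1), if_neg (by omega : ¬ 0 = k - 1),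
    if_neg (by omega : ¬ k - 1 = j + 1), if_pos rfl]
  by_cases h1 : i + 2 < k
  · rw [if_pos h1, proj_xy _ _ _ _ (by omega), if_neg (by omega : ¬ i = k - 1),
      if_neg (by omega : ¬ i + 1 = k - 1)]
    simp
  · rw [if_neg h1]
    by_cases h2 : i + 2 = k
    · rw [if_pos h2, if_neg (by omega : ¬ i = j), if_neg (by omega : ¬ i = k - 1)]; simp
    · rw [if_neg h2, if_neg (by omega : ¬ i = j), if_pos (by omega : i = k - 1)]; simp

lemma NN0_xy {k : ℕ} (j : ℕ) {x y : ℝ} (hx : 0 ≤ x) (hy : 0 ≤ y) : NN0 (xy k j x y) :=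
  ((NN0_evec j).smul hx).add ((NN0_evec _).smul hy)

lemma not_GG_xy {k : ℕ} (hk : 2 ≤ k) (j : ℕ) (hj : j + 2 ≤ k) : ∀ (n : ℕ → ℕ) (x y : ℝ), 0 < y →
    GG n (xy k j x y) → ∀ i, i < j → n i = 0 := by
  induction j with
  | zero => intro n x y hy h i hi; omega
  | succ j ih =>
    intro n x y hy h i hi
    have h0 : proj (xy k (j + 1) x y) 0 = 0 := by
      rw [proj_xy _ _ _ _ (by omega), if_neg (by omega), if_neg (by omega)]; ring
    have h1 : proj (xy k (j + 1) x y) (k - 1) = y := by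
      rw [proj_xy _ _ _ _ (by omega), if_neg (by omega), if_pos rfl]; ring
    obtain ⟨_, h | h⟩ := GG_iff.1 h
    · unfold TT at h
      rw [h0, h1] at h
      have : 0 < ((n 0 : ℝ) + 1) * y := by positivity
      linarith
    · have h2 := h.nn (k - 2) (by omega)
      rw [Mi_pen hk, h0, h1] at h2
      have h3 : n 0 = 0 := by
        by_contra hne
        have : 0 < (n 0 : ℝ) := by exact_mod_cast Nat.pos_of_ne_zero hne
        have : 0 < (n 0 : ℝ) * y := by positivity
        linarith
      rw [h3, Mi_xy hk j (by omega)] at h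
      cases i with
      | zero => exact h3
      | succ i => exact ih (by omega) (sh n) x y hy h i (by omega)

lemma GG_xy {k : ℕ} (hk : 2 ≤ k) (j : ℕ) (hj : j + 2 ≤ k) : ∀ (n : ℕ → ℕ) (x y : ℝ), 0 ≤ x →
    0 ≤ y → ((n j : ℝ) + 1) * y ≤ x → (∀ i, i < j → n i = 0) → GG n (xy k j x y) := by
  induction j with
  | zero =>
    intro n x y hx hy h _
    refine GG_iff.2 ⟨NN0_xy _ hx hy, Or.inl ?_⟩
    unfold TT
    rw [proj_xy _ _ _ _ (by omega), proj_xy _ _ _ _ (by omega), if_neg (by omega), if_pos rfl,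
      if_pos rfl, if_neg (by omega)]
    linarith
  | succ j ih =>
    intro n x y hx hy h h'
    refine GG_iff.2 ⟨NN0_xy _ hx hy, Or.inr ?_⟩
    rw [h' 0 (by omega), Mi_xy hk j (by omega)]
    exact ih (by omega) (sh n) x y hx hy h fun i hi => h' (i + 1) (by omega)

lemma ExtRay_base_aux {k : ℕ} (hk : 2 ≤ k) {n : ℕ → ℕ}
    (hn : ∃ t, 1 ≤ t ∧ t ≤ k - 2 ∧ n t ≠ 0) {a b : E k} (ha : GG n a) (hb : GG n b)
    (hab : a + b = Mv (n 0) (evec k (k - 2))) :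
    ((n 0 : ℝ) + 1) * proj a (k - 1) ≤ proj a 0 := by
  by_contra hlt
  have h1 := (GG_iff.1 ha).2.resolve_left hlt
  push Not at hlt
  obtain ⟨t, ht1, ht2, ht⟩ := hn
  have hmid : ∀ i, 0 < i → i + 1 < k → proj a i = 0 := by
    intro i hi hi'
    have := congrArg (fun v => proj v i) hab
    simp only [proj_add] at this
    rw [proj_Mv_pen hk _ _ (by omega), if_neg (by omega), if_neg (by omega)] at this
    have h2 := ha.nn i (by omega)
    have h3 := hb.nn i (by omega)
    linarith
  have e : Mi (n 0) a = xy k (k - 2) (proj a 0 - n 0 * proj a (k - 1))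
      (((n 0 : ℝ) + 1) * proj a (k - 1) - proj a 0) := by
    apply proj_ext; intro i hi
    rw [proj_Mi _ _ _ hi, proj_xy _ _ _ _ hi]
    by_cases h1 : i + 2 < k
    · rw [if_pos h1, if_neg (by omega), if_neg (by omega), hmid _ (by omega) (by omega)]; ring
    · rw [if_neg h1]
      by_cases h2 : i + 2 = k
      · rw [if_pos h2, if_pos (by omega), if_neg (by omega)]; ring
      · rw [if_neg h2, if_neg (by omega), if_pos (by omega)]; ring
  rw [e] at h1
  have := not_GG_xy hk (k - 2) (by omega) (sh n) _ _ (by linarith) h1 (t - 1) (by omega)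
  apply ht
  rw [← this]; unfold sh; congr 1; omega

lemma GG_evec {k : ℕ} (hk : 2 ≤ k) (n : ℕ → ℕ) (i : ℕ) (hi : i + 2 ≤ k) : GG n (evec k i) := by
  refine GG_iff.2 ⟨NN0_evec _, Or.inl ?_⟩
  unfold TT
  rw [proj_evec _ _ (by omega), if_neg (by omega)]
  have := NN0_evec (k := k) i 0 (by omega)
  linarith

lemma ExtRay_base {k : ℕ} (hk : 2 ≤ k) {n : ℕ → ℕ}
    (hn : ∃ t, 1 ≤ t ∧ t ≤ k - 2 ∧ n t ≠ 0) : ExtRay n (Mv (n 0) (evec k (k - 2))) := by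
  refine ⟨GG_Mv hk (GG_evec hk _ _ (by omega)), ?_⟩
  intro a b ha hb hab
  have h1 := ExtRay_base_aux hk hn ha hb hab
  have h2 := ExtRay_base_aux hk hn hb ha (by rw [add_comm]; exact hab)
  have hmid : ∀ i, i < k → proj a i + proj b i =
      if i = 0 then (n 0 : ℝ) + 1 else if i + 1 = k then 1 else 0 := fun i hi => by
    have := congrArg (fun v => proj v i) hab
    simp only [proj_add] at this
    rw [proj_Mv_pen hk _ _ hi] at this
    exact this
  refine ⟨proj a (k - 1), ?_⟩
  apply proj_ext; intro i hi
  rw [proj_smul, proj_Mv_pen hk _ _ hi]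
  have h3 := hmid 0 (by omega)
  have h4 := hmid (k - 1) (by omega)
  rw [if_pos rfl] at h3
  rw [if_neg (by omega), if_pos (by omega)] at h4
  split_ifs with h5 h6
  · subst h5
    have : ((n 0 : ℝ) + 1) * (proj a (k-1) + proj b (k-1)) = (n 0 : ℝ) + 1 := by rw [h4, mul_one]
    linarith
  · have : i = k - 1 := by omega
    subst this; ring
  · have h7 := hmid i hi
    rw [if_neg h5, if_neg h6] at h7
    have h2 := ha.nn i (by omega)
    have h3 := hb.nn i (by omega)
    linarith

lemma ExtRay_Mv {k : ℕ} (hk : 2 ≤ k) {n : ℕ → ℕ} {c : E k} (hc : ExtRay (sh n) c)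
    (hpos : 0 < proj c (k - 1)) : ExtRay n (Mv (n 0) c) := by
  refine ⟨GG_Mv hk hc.1, ?_⟩
  have key : ∀ a : E k, GG n a → ∃ δ : ℝ, δ > 0 ∧ ∀ ε : ℝ, 0 ≤ ε → ε ≤ δ → GG (sh n) (c + ε • Mi (n 0) a) := by
    intro a ha
    set p := proj (Mi (n 0) a) (k - 1) with hp
    refine ⟨proj c (k-1) / (|p| + 1), by positivity, ?_⟩
    intro ε he0 he
    have h1 : GG n (Mv (n 0) c + ε • a) := GG_add hk (GG_Mv hk hc.1) (GG_smul ha he0)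
    have h2 : Mi (n 0) (Mv (n 0) c + ε • a) = c + ε • Mi (n 0) a := by
      rw [Mi_add, Mi_Mv hk, Mi_smul]
    rw [← h2]
    refine (GG_iff.1 h1).2.resolve_left ?_
    intro hT
    have h3 : proj (Mi (n 0) (Mv (n 0) c + ε • a)) (k - 1) ≤ 0 := by
      rw [Mi_last hk]; unfold TT at hT; linarith
    rw [h2, proj_add, proj_smul, ← hp] at h3
    have h4 : ε * (|p| + 1) ≤ proj c (k-1) := by
      rw [le_div_iff₀ (by positivity)] at he; exact he
    have h5 : -(ε * |p|) ≤ ε * p := by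
      rw [← mul_neg]; exact mul_le_mul_of_nonneg_left (neg_abs_le p) he0
    rcases he0.eq_or_lt with h | h
    · subst h; simp at h3; linarith
    · nlinarith
  intro a b ha hb hab
  obtain ⟨δ1, h1, h1'⟩ := key a ha
  obtain ⟨δ2, h2, h2'⟩ := key b hb
  set δ := min δ1 δ2
  have hδ : 0 < δ := lt_min h1 h2
  have ga := h1' δ hδ.le (min_le_left _ _)
  have gb := h2' δ hδ.le (min_le_right _ _)
  have hpos2 : 0 < 2 + δ := by linarith
  obtain ⟨t, ht⟩ := hc.2 ((2 + δ)⁻¹ • (c + δ • Mi (n 0) a)) ((2 + δ)⁻¹ • (c + δ • Mi (n 0) b))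
    (GG_smul ga (by positivity)) (GG_smul gb (by positivity)) (by
      have : Mi (n 0) a + Mi (n 0) b = c := by rw [← Mi_add, hab, Mi_Mv hk]
      rw [← smul_add]
      have : (c + δ • Mi (n 0) a) + (c + δ • Mi (n 0) b) = (2 + δ) • c := by
        conv_rhs => rw [add_smul, two_smul]
        nth_rewrite 5 [← this]
        rw [smul_add]; abel
      rw [this, smul_smul, inv_mul_cancel₀ hpos2.ne', one_smul])
  refine ⟨((2 + δ) * t - 1) / δ, ?_⟩
  have e : Mi (n 0) a = (((2 + δ) * t - 1) / δ) • c := by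
    apply proj_ext; intro i hi
    have := congrArg (fun v => proj v i) ht
    simp only [proj_smul, proj_add] at this ⊢
    field_simp at this ⊢
    linarith
  rw [← Mv_smul, ← e, Mv_Mi hk]

lemma MM_last_pos {k : ℕ} (hk : 2 ≤ k) {c : E k} (hc : NN0 c)
    (hc' : 0 < proj c (k - 2) + proj c (k - 1)) (s : ℕ) : ∀ n, 0 < proj (MM n s c) (k - 1) := by
  induction s with
  | zero => intro n; show 0 < proj (Mv _ _) _; rw [Mv_last hk]; exact hc'
  | succ s ih =>
    intro n
    show 0 < proj (Mv _ _) _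
    rw [Mv_last hk]
    have := MM_NN0 hk hc s (sh n) (k - 2) (by omega)
    have := ih (sh n)
    linarith

lemma MM_pen_last_pos {k : ℕ} (hk : 2 ≤ k) (s : ℕ) (n : ℕ → ℕ) :
    0 < proj (MM n s (evec k (k - 2))) (k - 1) := by
  apply MM_last_pos hk (NN0_evec _)
  rw [proj_evec _ _ (by omega), proj_evec _ _ (by omega), if_pos rfl, if_neg (by omega)]
  norm_num

lemma ExtRay_MM {k : ℕ} (hk : 2 ≤ k) (s : ℕ) : ∀ (n : ℕ → ℕ),
    (∃ t, 1 ≤ t ∧ t ≤ k - 2 ∧ n (s + t) ≠ 0) → ExtRay n (MM n s (evec k (k - 2))) := by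
  induction s with
  | zero => intro n h; exact ExtRay_base hk (by simpa using h)
  | succ s ih =>
    intro n h
    refine ExtRay_Mv hk (ih (sh n) ?_) (MM_pen_last_pos hk _ _)
    obtain ⟨t, h1, h2, h3⟩ := h
    exact ⟨t, h1, h2, by unfold sh; rwa [show s + t + 1 = s + 1 + t by omega]⟩

/-! ### Converse -/

lemma ExtRay_Mi {k : ℕ} (hk : 2 ≤ k) {n : ℕ → ℕ} {c : E k} (hc : ExtRay n c)
    (h : GG (sh n) (Mi (n 0) c)) : ExtRay (sh n) (Mi (n 0) c) := by
  refine ⟨h, fun a b ha hb hab => ?_⟩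
  obtain ⟨t, ht⟩ := hc.2 _ _ (GG_Mv hk ha) (GG_Mv hk hb) (by rw [← Mv_add, hab, Mv_Mi hk])
  exact ⟨t, by rw [← Mi_smul, ← ht, Mi_Mv hk]⟩

lemma ExtRay_pen {k : ℕ} (hk : 2 ≤ k) {n : ℕ → ℕ} {t : ℝ} (ht : 0 < t)
    (hc : ExtRay n (t • Mv (n 0) (evec k (k - 2)))) : ∃ t, 1 ≤ t ∧ t ≤ k - 2 ∧ n t ≠ 0 := by
  by_contra hno
  push Not at hno
  set q := (n (k - 1) : ℝ) + 2 with hq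
  have hq0 : 0 < q := by positivity
  have g1 : GG (sh n) (xy k (k - 2) (t * (1 - 1 / q)) (t * (1 / q))) := by
    have h1 : (1:ℝ) - 1 / q = (n (k - 1) + 1) * (1 / q) := by
      field_simp; rw [hq]; ring
    apply GG_xy hk _ (by omega)
    · rw [h1]; positivity
    · positivity
    · have : sh n (k - 2) = n (k - 1) := by unfold sh; congr 1; omega
      rw [this, h1]; apply le_of_eq; ring
    · intro i hi; exact hno (i + 1) (by omega) (by omega)
  obtain ⟨s, hs⟩ := hc.2 ((t * (1 / q)) • evec k 0) _
    (GG_smul (GG_evec hk n 0 (by omega)) (by positivity)) (GG_Mv hk g1) (by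
      apply proj_ext; intro i hi
      rw [proj_add, proj_smul, proj_smul, proj_Mv_pen hk _ _ hi, proj_Mv _ _ _ hi,
        proj_evec _ _ hi, proj_xy _ _ _ _ (by omega), proj_xy _ _ _ _ (by omega),
        if_pos (rfl : k - 2 = k - 2), if_neg (by omega : ¬ k - 2 = k - 1),
        if_neg (by omega : ¬ k - 1 = k - 2), if_pos (rfl : k - 1 = k - 1)]
      split_ifs
      · ring
      · ring
      · rw [proj_xy _ _ _ _ (by omega), if_neg (by omega), if_neg (by omega)]; ring)
  have h1 := congrArg (fun v => proj v (k - 1)) hs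
  have h2 := congrArg (fun v => proj v 0) hs
  simp only [proj_smul] at h1 h2
  rw [proj_Mv_pen hk _ _ (by omega), proj_evec _ _ (by omega), if_neg (by omega),
    if_neg (by omega), if_pos (by omega)] at h1
  rw [proj_Mv_pen hk _ _ (by omega), proj_evec _ _ (by omega), if_pos rfl, if_pos rfl] at h2
  have : s = 0 := by
    have : s * (t * 1) = 0 := by linarith
    simp at this
    rcases this with h | h
    · exact h
    · linarith
  rw [this] at h2
  have : 0 < t * (1 / q) := by positivity
  linarith

lemma ExtRay_TT {k : ℕ} (hk : 2 ≤ k) {n : ℕ → ℕ} {c : E k} (hc0 : c ≠ 0) (hc : ExtRay n c)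
    (hT : TT (n 0) c) : ∃ t : ℝ, 0 < t ∧
      ((∃ i, i + 2 ≤ k ∧ c = t • evec k i) ∨ c = t • Mv (n 0) (evec k (k - 2))) := by
  have hn := hc.1.nn
  have GT : ∀ a : E k, NN0 a → TT (n 0) a → GG n a := fun a h h' => GG_iff.2 ⟨h, Or.inl h'⟩
  -- generic: if `c = x • v + b` then done
  have gen : ∀ (x : ℝ) (v : E k), 0 < x → GG n v → GG n (c + (-x) • v) → v ≠ 0 → NN0 v →
      ∃ t : ℝ, 0 < t ∧ c = t • v := by
    intro x v hx hv hb hv0 hvn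
    obtain ⟨s, hs⟩ := hc.2 (x • v) _ (GG_smul hv hx.le) hb (by rw [neg_smul]; abel)
    have hs0 : s ≠ 0 := by
      rintro rfl
      rw [zero_smul, smul_eq_zero] at hs
      rcases hs with h | h
      · exact hx.ne' h
      · exact hv0 h
    have e : c = (s⁻¹ * x) • v := by
      rw [mul_smul, hs, smul_smul, inv_mul_cancel₀ hs0, one_smul]
    refine ⟨_, ?_, e⟩
    have h1 : vsum c = (s⁻¹ * x) * vsum v := by
      conv_lhs => rw [e]
      rw [vsum_smul]
    have h2 : 0 < vsum c := lt_of_le_of_ne hn.vsum_nonneg fun h => hc0 (hn.eq_zero h.symm)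
    rw [h1] at h2
    exact pos_of_mul_pos_left h2 hvn.vsum_nonneg
  have evne : ∀ i, i < k → evec k i ≠ 0 := by
    intro i hi h
    have := vsum_evec i hi
    rw [h] at this
    simp [vsum, proj_zero] at this
  by_cases h1 : ∃ i, 0 < i ∧ i + 2 ≤ k ∧ 0 < proj c i
  · obtain ⟨i, hi0, hi, hci⟩ := h1
    obtain ⟨t, ht, e⟩ := gen (proj c i) (evec k i) hci (GG_evec hk n i hi) (by
      apply GT
      · intro j hj
        rw [proj_add, proj_smul, proj_evec _ _ hj]
        split_ifs with h
        · subst h; linarith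
        · have := hn j hj; linarith
      · unfold TT at *
        rw [proj_add, proj_smul, proj_evec _ _ (by omega), proj_add, proj_smul,
          proj_evec _ _ (by omega), if_neg (by omega), if_neg (by omega)]
        linarith) (evne _ (by omega)) (NN0_evec _)
    exact ⟨t, ht, Or.inl ⟨i, hi, e⟩⟩
  push Not at h1
  by_cases h2 : 0 < proj c (k - 1)
  · obtain ⟨t, ht, e⟩ := gen (proj c (k - 1)) (Mv (n 0) (evec k (k - 2))) h2
      (GG_Mv hk (GG_evec hk _ _ (by omega))) (by
      unfold TT at hT
      apply GT
      · intro j hj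
        rw [proj_add, proj_smul, proj_Mv_pen hk _ _ hj]
        split_ifs with h h'
        · subst h; linarith
        · have : j = k - 1 := by omega
          subst this; linarith
        · have := hn j hj; linarith
      · unfold TT
        rw [proj_add, proj_smul, proj_Mv_pen hk _ _ (by omega), proj_add, proj_smul,
          proj_Mv_pen hk _ _ (by omega), if_neg (by omega), if_pos (by omega), if_pos rfl]
        linarith) (by
          intro h
          have := proj_Mv_pen hk (n 0) (k - 1) (by omega)
          rw [h, proj_zero, if_neg (by omega), if_pos (by omega)] at this
          norm_num at this) (NN0_Mv hk _ (NN0_evec _))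
    exact ⟨t, ht, Or.inr e⟩
  · have h3 : proj c (k - 1) = 0 := le_antisymm (not_lt.1 h2) (hn _ (by omega))
    have e : c = proj c 0 • evec k 0 := by
      apply proj_ext; intro i hi
      rw [proj_smul, proj_evec _ _ hi]
      split_ifs with h
      · subst h; ring
      · rw [mul_zero]
        by_cases h' : i = k - 1
        · rw [h', h3]
        · exact le_antisymm (h1 i (by omega) (by omega)) (hn _ hi)
    refine ⟨proj c 0, lt_of_le_of_ne (hn _ (by omega)) fun h => hc0 ?_, Or.inl ⟨0, by omega, e⟩⟩
    rw [e, ← h, zero_smul]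

lemma ExtRay_Lo {k : ℕ} (hk : 2 ≤ k) (r : ℕ) : ∀ (n : ℕ → ℕ) (c : E k), c ≠ 0 → ExtRay n c →
    Lo r n c → ∃ t : ℝ, 0 < t ∧ ((∃ i, i + 2 ≤ k ∧ c = t • evec k i) ∨
      (∃ s, (∃ t, 1 ≤ t ∧ t ≤ k - 2 ∧ n (s + t) ≠ 0) ∧ c = t • MM n s (evec k (k - 2)))) := by
  have base : ∀ (n : ℕ → ℕ) (c : E k) , ExtRay n c → ∀ t : ℝ, 0 < t →
      c = t • Mv (n 0) (evec k (k - 2)) →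
      (∃ s, (∃ t, 1 ≤ t ∧ t ≤ k - 2 ∧ n (s + t) ≠ 0) ∧ c = t • MM n s (evec k (k - 2))) := by
    intro n c hc t ht h
    refine ⟨0, ?_, h⟩
    rw [h] at hc
    simpa using ExtRay_pen hk ht hc
  have baseT : ∀ (n : ℕ → ℕ) (c : E k), c ≠ 0 → ExtRay n c → TT (n 0) c →
      ∃ t : ℝ, 0 < t ∧ ((∃ i, i + 2 ≤ k ∧ c = t • evec k i) ∨
      (∃ s, (∃ t, 1 ≤ t ∧ t ≤ k - 2 ∧ n (s + t) ≠ 0) ∧ c = t • MM n s (evec k (k - 2)))) := by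
    intro n c h0 hc hT
    obtain ⟨t, ht, h | h⟩ := ExtRay_TT hk h0 hc hT
    · exact ⟨t, ht, Or.inl h⟩
    · exact ⟨t, ht, Or.inr (base n c hc t ht h)⟩
  induction r with
  | zero => rintro n c h0 hc ⟨-, h⟩; exact baseT n c h0 hc h
  | succ r ih =>
    rintro n c h0 hc ⟨-, h | h⟩
    · exact baseT n c h0 hc h
    obtain ⟨t, ht, h⟩ := ih (sh n) (Mi (n 0) c) (by
      intro h; apply h0
      rw [← Mv_Mi hk (n 0) c, h]
      have := Mv_smul (k := k) (n 0) 0 0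
      simpa using this) (ExtRay_Mi hk hc (Lo_gg h)) h
    refine ⟨t, ht, ?_⟩
    rcases h with ⟨i, hi, e⟩ | ⟨s, hs, e⟩
    · have e' : c = t • Mv (n 0) (evec k i) := by rw [← Mv_smul, ← e, Mv_Mi hk]
      by_cases hik : i + 2 < k
      · rw [Mv_evec _ _ hik] at e'
        exact Or.inl ⟨i + 1, by omega, e'⟩
      · have : i = k - 2 := by omega
        subst this
        exact Or.inr (base n c hc t ht e')
    · right
      refine ⟨s + 1, ?_, ?_⟩
      · obtain ⟨t, h1, h2, h3⟩ := hs
        exact ⟨t, h1, h2, by unfold sh at h3; rwa [show s + t + 1 = s + 1 + t by omega] at h3⟩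
      · show c = t • Mv _ _
        rw [← Mv_smul, ← e, Mv_Mi hk]

lemma it_smul {k : ℕ} (r : ℕ) : ∀ (n : ℕ → ℕ) (t : ℝ) (c : E k), it n r (t • c) = t • it n r c := by
  induction r with
  | zero => intro n t c; rfl
  | succ r ih => intro n t c; show it (sh n) r (Mi (n 0) (t • c)) = t • it (sh n) r (Mi (n 0) c); rw [Mi_smul, ih]

lemma it_add {k : ℕ} (r : ℕ) : ∀ (n : ℕ → ℕ) (c d : E k),
    it n r (c + d) = it n r c + it n r d := by
  induction r with
  | zero => intro n t c; rfl
  | succ r ih => intro n t c; show it (sh n) r (Mi (n 0) (t + c)) = it (sh n) r (Mi (n 0) t) + it (sh n) r (Mi (n 0) c); rw [Mi_add, ih]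

lemma Fib_smul {k : ℕ} {n : ℕ → ℕ} {c : E k} (h : Fib n c) {t : ℝ} (ht : 0 ≤ t) :
    Fib n (t • c) := fun r => by rw [it_smul]; exact (h r).smul ht

/-! ### Extreme points versus extreme rays -/

lemma ext_iff_ray {k : ℕ} (n : ℕ → ℕ) (α : E k) :
    α ∈ Set.extremePoints ℝ {α : E k | α ∈ simplex k ∧ GG n α} ↔
      α ∈ simplex k ∧ ExtRay n α := by
  constructor
  · rintro ⟨⟨h1, h2⟩, h3⟩
    refine ⟨h1, h2, ?_⟩
    intro a b ha hb hab
    have hs : vsum a + vsum b = 1 := by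
      rw [← vsum_add, hab]; exact ((mem_simplex α).1 h1).2
    rcases ha.nn.vsum_nonneg.eq_or_lt with h | h
    · exact ⟨0, by rw [ha.nn.eq_zero h.symm, zero_smul]⟩
    rcases hb.nn.vsum_nonneg.eq_or_lt with h' | h'
    · rw [hb.nn.eq_zero h'.symm, add_zero] at hab
      exact ⟨1, by rw [hab, one_smul]⟩
    have key : ∀ a : E k, GG n a → 0 < vsum a → (vsum a)⁻¹ • a ∈
        {α : E k | α ∈ simplex k ∧ GG n α} := by
      intro a ha h
      refine ⟨(mem_simplex _).2 ⟨ha.nn.smul (by positivity), ?_⟩, GG_smul ha (by positivity)⟩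
      rw [vsum_smul, inv_mul_cancel₀ h.ne']
    have := h3 (key a ha h) (key b hb h') ⟨vsum a, vsum b, h, h', hs, by
      rw [smul_smul, smul_smul, mul_inv_cancel₀ h.ne', mul_inv_cancel₀ h'.ne', one_smul, one_smul,
        hab]⟩
    exact ⟨vsum a, by rw [← this, smul_smul, mul_inv_cancel₀ h.ne', one_smul]⟩
  · rintro ⟨h1, h2, h3⟩
    refine ⟨⟨h1, h2⟩, ?_⟩
    rintro x ⟨hx, hx'⟩ y ⟨hy, hy'⟩ ⟨s, t, hs, ht, hst, e⟩
    obtain ⟨τ, hτ⟩ := h3 _ _ (GG_smul hx' hs.le) (GG_smul hy' ht.le) e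
    have : s = τ := by
      have := congrArg vsum hτ
      rw [vsum_smul, vsum_smul, ((mem_simplex _).1 hx).2, ((mem_simplex _).1 h1).2] at this
      linarith
    rw [← this] at hτ
    exact smul_right_injective _ hs.ne' hτ

/-! ### `Ups` versus `MM` -/

lemma Kinv_eq {k : ℕ} (hk : 2 ≤ k) (m : ℕ) {α : E k} (h : vsum α = 1) :
    Kinv m α = (vsum (Mv m α))⁻¹ • Mv m α := by
  apply proj_ext; intro i hi
  rw [proj_smul, proj_Mv _ _ _ hi, vsum_Mv hk, h]
  unfold Kinv
  rw [proj_mk _ _ hi, div_eq_inv_mul]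
  congr 2
  ring

lemma vsum_Mv_pos {k : ℕ} (hk : 2 ≤ k) (m : ℕ) {α : E k} (h0 : NN0 α) (h : 0 < vsum α) :
    0 < vsum (Mv m α) := by
  rw [vsum_Mv hk]
  have := h0 (k - 2) (by omega)
  have := h0 (k - 1) (by omega)
  positivity

lemma Kinv_simplex {k : ℕ} (hk : 2 ≤ k) (m : ℕ) {α : E k} (h : α ∈ simplex k) :
    Kinv m α ∈ simplex k := by
  obtain ⟨h1, h2⟩ := (mem_simplex _).1 h
  have := vsum_Mv_pos hk m h1 (by linarith)
  rw [Kinv_eq hk m h2, mem_simplex]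
  refine ⟨(NN0_Mv hk m h1).smul (by positivity), ?_⟩
  rw [vsum_smul, inv_mul_cancel₀ this.ne']

lemma Ups_succ {k : ℕ} (r : ℕ) : ∀ (n : ℕ → ℕ) (α : E k),
    Ups n (r + 1) α = Kinv (n 0) (Ups (sh n) r α) := by
  induction r with
  | zero => intro n α; rfl
  | succ r ih =>
    intro n α
    show Ups n (r + 1) (Kinv (n (r + 2)) α) = _
    rw [ih]; rfl

lemma Ups_simplex {k : ℕ} (hk : 2 ≤ k) (r : ℕ) : ∀ (n : ℕ → ℕ) (α : E k), α ∈ simplex k →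
    Ups n r α ∈ simplex k := by
  induction r with
  | zero => intro n α h; exact Kinv_simplex hk _ h
  | succ r ih => intro n α h; rw [Ups_succ]; exact Kinv_simplex hk _ (ih _ _ h)

lemma Ups_MM {k : ℕ} (hk : 2 ≤ k) (r : ℕ) : ∀ (n : ℕ → ℕ) (α : E k), α ∈ simplex k →
    ∃ t : ℝ, 0 < t ∧ Ups n r α = t • MM n r α := by
  induction r with
  | zero =>
    intro n α h
    obtain ⟨h1, h2⟩ := (mem_simplex _).1 h
    have := vsum_Mv_pos hk (n 0) h1 (by linarith)
    exact ⟨_, inv_pos.2 this, Kinv_eq hk _ h2⟩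
  | succ r ih =>
    intro n α h
    obtain ⟨t, ht, e⟩ := ih (sh n) α h
    obtain ⟨h1, h2⟩ := (mem_simplex _).1 (Ups_simplex hk r (sh n) α h)
    have := vsum_Mv_pos hk (n 0) h1 (by linarith)
    refine ⟨(vsum (Mv (n 0) (Ups (sh n) r α)))⁻¹ * t, by positivity, ?_⟩
    rw [Ups_succ, Kinv_eq hk _ h2]
    rw [mul_smul]
    congr 1
    rw [e, Mv_smul]; rfl

/-! ### The fiber -/

lemma Fib_coord {k : ℕ} (hk : 2 ≤ k) (j : ℕ) : ∀ (n : ℕ → ℕ) (c : E k),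
    (∀ r, proj (it n r c) 0 = 0) → j + 1 < k → proj c j = 0 := by
  induction j with
  | zero => intro n c h _; exact h 0
  | succ j ih =>
    intro n c h hj
    have := ih (sh n) (Mi (n 0) c) (fun r => h (r + 1)) (by omega)
    rwa [proj_Mi _ _ _ (by omega), if_pos (by omega)] at this

lemma Fib_last_zero {k : ℕ} (hk : 2 ≤ k) {n : ℕ → ℕ} {c : E k} (h : Fib n c)
    (h0 : proj c (k - 1) = 0) : c = 0 := by
  have key : ∀ r (n : ℕ → ℕ) (c : E k), Fib n c → proj c (k - 1) = 0 →
      proj (it n r c) 0 = 0 := by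
    intro r
    have z : ∀ (n : ℕ → ℕ) (c : E k), Fib n c → proj c (k - 1) = 0 → proj c 0 = 0 := by
      intro n c h h0
      have h1 := h.nn 0 (by omega)
      have h2 := (Fib_sh h).nn (k - 1) (by omega)
      rw [Mi_last hk, h0] at h2
      linarith
    induction r with
    | zero => exact z
    | succ r ih =>
      intro n c h h0
      apply ih _ _ (Fib_sh h)
      rw [Mi_last hk, h0, z n c h h0]; ring
  apply proj_ext; intro i hi
  rw [proj_zero]
  by_cases h' : i = k - 1
  · rw [h', h0]
  · exact Fib_coord hk i n c (fun r => key r n c h h0) (by omega)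

lemma Mi_ne_zero {k : ℕ} (hk : 2 ≤ k) (m : ℕ) {c : E k} (hc : c ≠ 0) : Mi m c ≠ 0 := by
  intro h; apply hc
  rw [← Mv_Mi hk m c, h]
  have := Mv_smul (k := k) m 0 0
  simpa using this

lemma Fib_last_pos {k : ℕ} (hk : 2 ≤ k) {n : ℕ → ℕ} {c : E k} (h : Fib n c)
    (h0 : c ≠ 0) : 0 < proj c (k - 1) :=
  lt_of_le_of_ne (h.nn _ (by omega)) fun h' => h0 (Fib_last_zero hk h h'.symm)

lemma simplex_ne_zero {k : ℕ} {α : E k} (h : α ∈ simplex k) : α ≠ 0 := by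
  rintro rfl
  have := ((mem_simplex _).1 h).2
  simp [vsum, proj_zero] at this

lemma Fib_Jfun {k : ℕ} (hk : 2 ≤ k) {n : ℕ → ℕ} {c : E k} (h : Fib n c)
    (h0 : c ≠ 0) : Jfun c = n 0 := by
  have h1 := Fib_last_pos hk h h0
  have h2 := Fib_last_pos hk (Fib_sh h) (Mi_ne_zero hk _ h0)
  have h3 := (Fib_sh h).nn (k - 2) (by omega)
  rw [Mi_last hk] at h2
  rw [Mi_pen hk] at h3
  unfold Jfun
  rw [Nat.floor_eq_iff (div_nonneg (h.nn 0 (by omega)) h1.le)]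
  constructor
  · rw [le_div_iff₀ h1]; linarith
  · rw [div_lt_iff₀ h1]; linarith

lemma proj_zero_lt_one {k : ℕ} (hk : 2 ≤ k) {α : E k} (h : α ∈ simplex k)
    (h1 : 0 < proj α (k - 1)) : proj α 0 < 1 := by
  obtain ⟨h2, h3⟩ := (mem_simplex _).1 h
  obtain ⟨d, rfl⟩ : ∃ d, k = d + 2 := ⟨k - 2, by omega⟩
  unfold vsum at h3
  rw [Finset.sum_range_succ, Finset.sum_range_succ'] at h3
  have : 0 ≤ ∑ i ∈ Finset.range d, proj α (i + 1) :=
    Finset.sum_nonneg fun i hi => h2 _ (by have := Finset.mem_range.1 hi; omega)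
  have h1' : 0 < proj α (d + 1) := h1
  linarith

lemma Kmap_eq {k : ℕ} (m : ℕ) (α : E k) :
    Kmap m α = (1 - proj α 0)⁻¹ • Mi m α := by
  apply proj_ext; intro i hi
  rw [proj_smul, proj_Mi _ _ _ hi]
  unfold Kmap
  rw [proj_mk _ _ hi]
  split_ifs <;> rw [div_eq_inv_mul]

lemma Kmap_simplex {k : ℕ} (hk : 2 ≤ k) (m : ℕ) {α : E k} (h : α ∈ simplex k)
    (h1 : 0 < proj α (k - 1)) (h2 : NN0 (Mi m α)) : Kmap m α ∈ simplex k := by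
  have := proj_zero_lt_one hk h h1
  rw [Kmap_eq, mem_simplex]
  refine ⟨h2.smul (inv_nonneg.2 (by linarith)), ?_⟩
  rw [vsum_smul, vsum_Mi hk, ((mem_simplex _).1 h).2, inv_mul_cancel₀ (by linarith)]

lemma Fib_Phi {k : ℕ} (hk : 2 ≤ k) (r : ℕ) : ∀ (n : ℕ → ℕ) (α : E k), α ∈ simplex k →
    Fib n α → Jfun (Kstep^[r] α) = n r := by
  induction r with
  | zero => intro n α h h'; exact Fib_Jfun hk h' (simplex_ne_zero h)
  | succ r ih =>
    intro n α h h'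
    have h1 := Fib_last_pos hk h' (simplex_ne_zero h)
    have h2 := proj_zero_lt_one hk h h1
    rw [Function.iterate_succ_apply]
    have e : Kstep α = Kmap (n 0) α := by
      unfold Kstep; rw [Fib_Jfun hk h' (simplex_ne_zero h)]
    rw [e]
    apply ih (sh n) _ (Kmap_simplex hk _ h h1 (Fib_sh h').nn)
    rw [Kmap_eq]
    exact Fib_smul (Fib_sh h') (inv_nonneg.2 (by linarith))

lemma Phi_Fib {k : ℕ} (hk : 2 ≤ k) (r : ℕ) : ∀ (n : ℕ → ℕ) (α : E k), α ∈ simplex k →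
    0 < proj α (k - 1) → Phi α = n → NN0 (it n r α) := by
  induction r with
  | zero => intro n α h _ _; exact ((mem_simplex _).1 h).1
  | succ r ih =>
    intro n α h h1 hP
    have h2 := proj_zero_lt_one hk h h1
    have hn := ((mem_simplex _).1 h).1
    have hJ : Jfun α = n 0 := by rw [← hP]; rfl
    have hfl := hJ
    unfold Jfun at hfl
    rw [Nat.floor_eq_iff (div_nonneg (hn 0 (by omega)) h1.le), le_div_iff₀ h1, div_lt_iff₀ h1] at hfl
    have hl : 0 < proj (Mi (n 0) α) (k - 1) := by rw [Mi_last hk]; linarith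
    have hM : NN0 (Mi (n 0) α) := by
      intro i hi
      rw [proj_Mi _ _ _ hi]
      split_ifs
      · exact hn _ (by omega)
      · linarith
      · linarith
    have e : Kstep α = Kmap (n 0) α := by unfold Kstep; rw [hJ]
    have := ih (sh n) (Kstep α) (by rw [e]; exact Kmap_simplex hk _ h h1 hM) (by
      rw [e, Kmap_eq, proj_smul]; exact mul_pos (inv_pos.2 (by linarith)) hl) (by
      rw [← hP]; funext s
      show Jfun _ = Jfun _
      rw [Function.iterate_succ_apply])
    show NN0 (it (sh n) r (Mi (n 0) α))
    rw [e, Kmap_eq, it_smul] at this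
    have h3 := this.smul (t := 1 - proj α 0) (by linarith)
    rwa [smul_smul, mul_inv_cancel₀ (by linarith), one_smul] at h3

lemma mem_PhiFiber {k : ℕ} (hk : 2 ≤ k) (n : ℕ → ℕ) (α : E k) :
    α ∈ PhiFiber k n ↔ α ∈ simplex k ∧ Fib n α := by
  constructor
  · rintro ⟨⟨h1, h2⟩, h3⟩
    refine ⟨h1, fun r => Phi_Fib hk r n α h1 ?_ h3⟩
    refine lt_of_le_of_ne (((mem_simplex _).1 h1).1 _ (by omega)) fun h => h2 ⟨h1, h.symm⟩
  · rintro ⟨h1, h2⟩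
    refine ⟨⟨h1, fun h => ?_⟩, ?_⟩
    · exact (Fib_last_pos hk h2 (simplex_ne_zero h1)).ne' h.2
    · funext r; exact Fib_Phi hk r n α h1 h2

/-! ### Integer points of the fiber cone -/

def IntV {k : ℕ} (c : E k) : Prop := ∀ i, i < k → ∃ z : ℤ, proj c i = z

lemma IntV_Mi {k : ℕ} (hk : 2 ≤ k) (m : ℕ) {c : E k} (h : IntV c) : IntV (Mi m c) := by
  intro i hi
  rw [proj_Mi _ _ _ hi]
  obtain ⟨x, hx⟩ := h 0 (by omega)
  obtain ⟨y, hy⟩ := h (k - 1) (by omega)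
  split_ifs
  · exact h _ (by omega)
  · exact ⟨x - m * y, by rw [hx, hy]; push_cast; ring⟩
  · exact ⟨(m + 1) * y - x, by rw [hx, hy]; push_cast; ring⟩

lemma IntV_it {k : ℕ} (hk : 2 ≤ k) (r : ℕ) : ∀ (n : ℕ → ℕ) (c : E k), IntV c →
    IntV (it n r c) := by
  induction r with
  | zero => intro n c h; exact h
  | succ r ih => intro n c h; exact ih _ _ (IntV_Mi hk _ h)

lemma it_succ' {k : ℕ} (r : ℕ) : ∀ (n : ℕ → ℕ) (c : E k),
    it n (r + 1) c = Mi (n r) (it n r c) := by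
  induction r with
  | zero => intro n c; rfl
  | succ r ih => intro n c; show it (sh n) (r + 1) _ = _; rw [ih]; rfl

lemma IntV_vsum {k : ℕ} {c : E k} (h : IntV c) (h0 : NN0 c) : ∃ z : ℕ, vsum c = z := by
  have : ∀ j, j ≤ k → ∃ z : ℤ, ∑ i ∈ Finset.range j, proj c i = z := by
    intro j
    induction j with
    | zero => intro _; exact ⟨0, by simp⟩
    | succ j ih =>
      intro hj
      obtain ⟨z, hz⟩ := ih (by omega)
      obtain ⟨y, hy⟩ := h j (by omega)
      exact ⟨z + y, by rw [Finset.sum_range_succ, hz, hy]; push_cast; ring⟩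
  obtain ⟨z, hz⟩ := this k le_rfl
  have hz' : vsum c = z := hz
  have h1 := h0.vsum_nonneg
  rw [hz'] at h1
  have h2 : 0 ≤ z := by exact_mod_cast h1
  obtain ⟨y, rfl⟩ := Int.eq_ofNat_of_zero_le h2
  exact ⟨y, by rw [hz']; simp⟩

lemma it_shift {k : ℕ} (s : ℕ) : ∀ (r : ℕ) (n : ℕ → ℕ) (c : E k),
    it n (r + s) c = it (fun j => n (r + j)) s (it n r c) := by
  induction s with
  | zero => intro r n c; rfl
  | succ s ih => intro r n c; rw [← add_assoc, it_succ', it_succ', ih]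

lemma IntV_Fib {k : ℕ} (hk : 2 ≤ k) {n : ℕ → ℕ} {c : E k} (h : IntV c) (hF : Fib n c) :
    ∃ R, ∀ r, R ≤ r → it n r c = proj (it n r c) (k - 1) • evec k (k - 1) := by
  choose z hz using fun r => IntV_vsum (IntV_it hk r n c h) (hF r)
  have hstep : ∀ r, vsum (it n (r + 1) c) = vsum (it n r c) - proj (it n r c) 0 := by
    intro r; rw [it_succ', vsum_Mi hk]
  have hanti : Antitone z := by
    apply antitone_nat_of_succ_le
    intro r
    have h1 := hstep r
    have h2 := hF r 0 (by omega)
    rw [hz, hz] at h1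
    have : (z (r + 1) : ℝ) ≤ z r := by linarith
    exact_mod_cast this
  obtain ⟨R, hR⟩ : ∃ R, ∀ r, z R ≤ z r := by
    have hne : ∃ y, ∃ r, z r = y := ⟨_, 0, rfl⟩
    obtain ⟨R, hR⟩ := Nat.find_spec hne
    exact ⟨R, fun r => by rw [hR]; exact Nat.find_min' hne ⟨r, rfl⟩⟩
  have hconst : ∀ r, R ≤ r → z r = z R := fun r hr => le_antisymm (hanti hr) (hR r)
  have hzero : ∀ r, R ≤ r → proj (it n r c) 0 = 0 := by
    intro r hr
    have := hstep r
    rw [hz, hz, hconst r hr, hconst (r + 1) (by omega)] at this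
    linarith
  refine ⟨R, fun r hr => ?_⟩
  apply proj_ext; intro i hi
  rw [proj_smul, proj_evec _ _ hi]
  split_ifs with hik
  · rw [hik, mul_one]
  · rw [mul_zero]
    apply Fib_coord hk i (fun j => n (r + j)) _ _ (by omega)
    intro s
    rw [← it_shift]
    exact hzero _ (by omega)

lemma it_injective {k : ℕ} (hk : 2 ≤ k) (r : ℕ) : ∀ (n : ℕ → ℕ) (c : E k), it n r c = 0 →
    c = 0 := by
  induction r with
  | zero => intro n c h; exact h
  | succ r ih =>
    intro n c h
    by_contra h0
    exact Mi_ne_zero hk (n 0) h0 (ih _ _ h)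

lemma IntV_Fib_two {k : ℕ} (hk : 2 ≤ k) {n : ℕ → ℕ} {c : E k} (h : IntV c) (hF : Fib n c)
    (h' : IntV (c + evec k 0)) (hF' : Fib n (c + evec k 0)) : False := by
  obtain ⟨R, hR⟩ := IntV_Fib hk h hF
  obtain ⟨R', hR'⟩ := IntV_Fib hk h' hF'
  set r := max R R'
  have h1 := hR r (le_max_left _ _)
  have h2 := hR' r (le_max_right _ _)
  set x := proj (it n r c) (k - 1)
  set y := proj (it n r (c + evec k 0)) (k - 1)
  have hy0 : c + evec k 0 ≠ 0 := by
    intro h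
    have := congrArg (fun v => proj v 0) h
    simp only [proj_add, proj_zero] at this
    rw [proj_evec _ _ (by omega), if_pos rfl] at this
    have := hF.nn 0 (by omega)
    linarith
  have hyne : y ≠ 0 := by
    intro h0
    rw [h0, zero_smul] at h2
    exact hy0 (it_injective hk r n _ h2)
  -- c = (x / y) (c + e_0)
  have h3 : it n r (c + (-(x / y)) • (c + evec k 0)) = 0 := by
    rw [it_add, it_smul, h1, h2, smul_smul, ← add_smul]
    have : x + -(x / y) * y = 0 := by field_simp; ring
    rw [this, zero_smul]
  have h4 := it_injective hk r n _ h3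
  have hlast := congrArg (fun v => proj v (k - 1)) h4
  have hfst := congrArg (fun v => proj v 0) h4
  simp only [proj_add, proj_smul, proj_zero] at hlast hfst
  rw [proj_evec _ _ (by omega), if_neg (by omega)] at hlast
  rw [proj_evec _ _ (by omega), if_pos rfl] at hfst
  have hpos : 0 < proj c (k - 1) := by
    have := Fib_last_pos hk hF' hy0
    rwa [proj_add, proj_evec _ _ (by omega), if_neg (by omega), add_zero] at this
  have : x / y = 1 := by
    have : proj c (k - 1) * (1 - x / y) = 0 := by linarith
    rcases mul_eq_zero.1 this with h | h <;> linarith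
  rw [this] at hfst
  linarith

/-- Approximation of points in the fiber cone by points in the lower cones. -/
lemma Fib_approx {k : ℕ} (hk : 2 ≤ k) {n : ℕ → ℕ} {c : E k} (hF : Fib n c) (δ : ℝ) (hδ : 0 < δ) :
    ∃ d : E k, (∃ r, Lo r n d) ∧ ∀ i, i < k → |proj c i - proj d i| ≤ δ := by
  obtain ⟨D, hD⟩ := exists_nat_gt (((n 0 : ℝ) + 3) / δ)
  have hD0 : (0 : ℝ) < D := lt_trans (by positivity) hD
  have hDδ : ((n 0 : ℝ) + 3) / D ≤ δ := by
    rw [div_le_iff₀ hD0]; rw [div_lt_iff₀ hδ] at hD; linarith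
  set z : E k := (WithLp.equiv 2 (Fin k → ℝ)).symm fun i =>
    (⌊D * proj c i⌋ : ℝ) + 1 + if (i : ℕ) = 0 then (n 0 : ℝ) + 1 else 0 with hz
  have hzp : ∀ i, i < k → proj z i = (⌊D * proj c i⌋ : ℝ) + 1 + if i = 0 then (n 0 : ℝ) + 1 else 0 := by
    intro i hi; rw [hz, proj_mk _ _ hi]
  have hlo : ∀ i, i < k → D * proj c i + (if i = 0 then (n 0 : ℝ) + 1 else 0) ≤ proj z i := by
    intro i hi; rw [hzp i hi]; have := Int.lt_floor_add_one (D * proj c i); linarith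
  have hhi : ∀ i, i < k → proj z i ≤ D * proj c i + 1 + (if i = 0 then (n 0 : ℝ) + 1 else 0) := by
    intro i hi; rw [hzp i hi]; have := Int.floor_le (D * proj c i); linarith
  have hzI : IntV z := by
    intro i hi
    refine ⟨⌊D * proj c i⌋ + 1 + if i = 0 then (n 0 : ℤ) + 1 else 0, ?_⟩
    rw [hzp i hi]; push_cast; rfl
  have hzI' : IntV (z + evec k 0) := by
    intro i hi
    obtain ⟨y, hy⟩ := hzI i hi
    refine ⟨y + if i = 0 then 1 else 0, ?_⟩
    rw [proj_add, hy, proj_evec _ _ hi]; push_cast; rfl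
  have hgz : GG n z := by
    have e : z = (D : ℝ) • c + (z + (-(D : ℝ)) • c) := by rw [neg_smul]; abel
    rw [e]
    apply GG_add hk (GG_smul hF.gg hD0.le)
    refine GG_iff.2 ⟨?_, Or.inl ?_⟩
    · intro i hi
      rw [proj_add, proj_smul]
      have := hlo i hi
      split_ifs at this
      · have : (0 : ℝ) ≤ n 0 := Nat.cast_nonneg _
        linarith
      · linarith
    · unfold TT
      rw [proj_add, proj_smul, proj_add, proj_smul]
      have h1 := hlo 0 (by omega)
      have h2 := hhi (k - 1) (by omega)
      rw [if_pos rfl] at h1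
      rw [if_neg (by omega)] at h2
      have : ((n 0 : ℝ) + 1) * (proj z (k - 1) + -(D : ℝ) * proj c (k - 1)) ≤ ((n 0 : ℝ) + 1) * 1 :=
        mul_le_mul_of_nonneg_left (by linarith) (by positivity)
      linarith
  have hgz' : GG n (z + evec k 0) := GG_add hk hgz (GG_evec hk n 0 (by omega))
  have hmain : ∃ d : E k, (∃ r, Lo r n d) ∧ ∀ i, i < k → |D * proj c i - proj d i| ≤ (n 0 : ℝ) + 3 := by
    have hn0 : (0 : ℝ) ≤ n 0 := Nat.cast_nonneg _
    rcases GG_cases hgz with h | h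
    · refine ⟨z, h, fun i hi => ?_⟩
      have h1 := hlo i hi
      have h2 := hhi i hi
      rw [abs_le]
      split_ifs at h1 h2 <;> constructor <;> linarith
    · rcases GG_cases hgz' with h' | h'
      · refine ⟨_, h', fun i hi => ?_⟩
        have h1 := hlo i hi
        have h2 := hhi i hi
        rw [abs_le, proj_add, proj_evec _ _ hi]
        split_ifs at h1 h2 ⊢ <;> constructor <;> linarith
      · exact (IntV_Fib_two hk hzI h hzI' h').elim
  obtain ⟨d, ⟨r, hr⟩, hd⟩ := hmain
  refine ⟨(D : ℝ)⁻¹ • d, ⟨r, Lo_smul r n d hr _ (by positivity)⟩, fun i hi => ?_⟩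
  have e : proj c i - proj ((D : ℝ)⁻¹ • d) i = (D * proj c i - proj d i) / D := by
    rw [proj_smul]; field_simp
  rw [e, abs_div, abs_of_pos hD0]
  exact le_trans (div_le_div_of_nonneg_right (hd i hi) hD0.le) hDδ

/-- Final assembly, given the description of `DF(n)`. -/
lemma final {k : ℕ} (hk : 2 ≤ k) (n : ℕ → ℕ)
    (hDF : DFn k n = {α : E k | α ∈ simplex k ∧ GG n α}) :
    FEset k n ⊆ Eset k n ∧
    Eset k n ⊆ FEset k n ∪ Set.extremePoints ℝ (PhiFiber k n) := by
  have hes : evec k (k - 2) ∈ simplex k := (mem_simplex _).2 ⟨NN0_evec _, vsum_evec _ (by omega)⟩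
  constructor
  · rintro α ⟨s, hs, rfl⟩
    obtain ⟨t, ht, e⟩ := Ups_MM hk s n _ hes
    refine ⟨?_, ?_⟩
    · rw [hDF, ext_iff_ray]
      refine ⟨Ups_simplex hk s n _ hes, ?_⟩
      have hr := ExtRay_MM hk s n hs
      rw [e]
      refine ⟨GG_smul hr.1 ht.le, fun a b ha hb hab => ?_⟩
      obtain ⟨u, hu⟩ := hr.2 (t⁻¹ • a) (t⁻¹ • b) (GG_smul ha (by positivity))
        (GG_smul hb (by positivity)) (by
          rw [← smul_add, hab, smul_smul, inv_mul_cancel₀ ht.ne', one_smul])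
      refine ⟨u, ?_⟩
      rw [smul_comm, ← hu, smul_smul, mul_inv_cancel₀ ht.ne', one_smul]
    · rintro ⟨i, hi, h⟩
      have h1 := MM_pen_last_pos hk s n
      have h2 := congrArg (fun v => proj v (k - 1)) (e.symm.trans h)
      simp only [proj_smul] at h2
      rw [proj_evec _ _ (by omega), if_neg (by omega)] at h2
      have : 0 < t * proj (MM n s (evec k (k - 2))) (k - 1) := by positivity
      linarith
  · rintro α ⟨h, hne⟩
    have hα := h
    rw [hDF, ext_iff_ray] at hα
    obtain ⟨hs, hr⟩ := hα
    rcases GG_cases hr.1 with ⟨r, hL⟩ | hF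
    · left
      obtain ⟨t, ht, ⟨i, hi, e⟩ | ⟨s, hsn, e⟩⟩ := ExtRay_Lo hk r n α (simplex_ne_zero hs) hr hL
      · refine (hne ⟨i, by omega, ?_⟩).elim
        have := congrArg vsum e
        rw [vsum_smul, vsum_evec _ (by omega), ((mem_simplex _).1 hs).2] at this
        rw [e, ← (by linarith : (1:ℝ) = t), one_smul]
      · refine ⟨s, hsn, ?_⟩
        obtain ⟨u, hu, e'⟩ := Ups_MM hk s n _ hes
        have h1 := congrArg vsum e
        have h2 := congrArg vsum e'
        rw [vsum_smul, ((mem_simplex _).1 hs).2] at h1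
        rw [vsum_smul, ((mem_simplex _).1 (Ups_simplex hk s n _ hes)).2] at h2
        have : t = u := by
          have hv : vsum (MM n s (evec k (k - 2))) ≠ 0 := by
            intro h; rw [h] at h1; simp at h1
          exact mul_right_cancel₀ hv (h1.symm.trans h2)
        rw [e, e', this]
    · right
      refine ⟨(mem_PhiFiber hk n α).2 ⟨hs, hF⟩, ?_⟩
      intro x hx y hy hxy
      have hsub : ∀ x, x ∈ PhiFiber k n → x ∈ DFn k n := by
        intro x hx
        rw [mem_PhiFiber hk] at hx
        rw [hDF]
        exact ⟨hx.1, hx.2.gg⟩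
      exact h.2 (hsub x hx) (hsub y hy) hxy

/-! ### Finite words and sequences -/

def pre : Seq → ℕ → List ℕ
  | _, 0 => []
  | v, r + 1 => v 0 :: pre (shift v) r

def LeW : List ℕ → Seq → Prop
  | [], _ => True
  | a :: t, w => a < w 0 ∨ (a = w 0 ∧ LeW t (shift w))

def Adm (w : Seq) : List ℕ → Prop
  | [] => True
  | a :: t => LeW (a :: t) w ∧ Adm w t

def consSeq (a : ℕ) (s : Seq) : Seq
  | 0 => a
  | r + 1 => s r

def app : List ℕ → Seq → Seq
  | [], s => s
  | a :: t, s => consSeq a (app t s)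

@[simp] lemma consSeq_zero (a : ℕ) (s : Seq) : consSeq a s 0 = a := rfl
@[simp] lemma shift_consSeq (a : ℕ) (s : Seq) : shift (consSeq a s) = s := rfl
@[simp] lemma app_nil (s : Seq) : app [] s = s := rfl
@[simp] lemma app_cons (a : ℕ) (t : List ℕ) (s : Seq) : app (a :: t) s = consSeq a (app t s) := rfl

lemma app_append (l t : List ℕ) (s : Seq) : app (l ++ t) s = app l (app t s) := by
  induction l with
  | nil => rfl
  | cons a l ih => simp [ih]

lemma app_lt (l : List ℕ) (s : Seq) (i : ℕ) (h : i < l.length) : app l s i = l.getD i 0 := by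
  induction l generalizing i with
  | nil => simp at h
  | cons a l ih =>
    cases i with
    | zero => simp
    | succ i => simpa [consSeq] using ih i (by simpa using h)

lemma app_add (l : List ℕ) (s : Seq) (i : ℕ) : app l s (l.length + i) = s i := by
  induction l with
  | nil => simp
  | cons a l ih =>
    rw [List.length_cons, show l.length + 1 + i = (l.length + i) + 1 by omega]
    exact ih

lemma app_ge (l : List ℕ) (s : Seq) (i : ℕ) (h : l.length ≤ i) : app l s i = s (i - l.length) := by
  rw [← app_add l s (i - l.length)]; congr 1; omega

lemma LeW_app (l t : List ℕ) (s : Seq) : LeW (l ++ t) (app l s) ↔ LeW t s := by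
  induction l with
  | nil => rfl
  | cons a l ih => simp [LeW, ih]

lemma LeW_prefix : ∀ (u x : List ℕ) (w : Seq), LeW (u ++ x) w → LeW u w := by
  intro u
  induction u with
  | nil => intros; trivial
  | cons a u ih =>
    intro x w h
    rcases h with h | ⟨h, h'⟩
    · exact Or.inl h
    · exact Or.inr ⟨h, ih _ _ h'⟩

lemma Adm.leW {w : Seq} {u : List ℕ} (h : Adm w u) : LeW u w := by
  cases u with
  | nil => trivial
  | cons a t => exact h.1

lemma Adm_prefix {w : Seq} : ∀ {u x : List ℕ}, Adm w (u ++ x) → Adm w u := by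
  intro u
  induction u with
  | nil => intros; trivial
  | cons a u ih => intro x h; exact ⟨LeW_prefix (a :: u) x w h.1, ih h.2⟩

lemma Adm_suffix {w : Seq} : ∀ {u x : List ℕ}, Adm w (u ++ x) → Adm w x := by
  intro u
  induction u with
  | nil => intro x h; exact h
  | cons a u ih => intro x h; exact ih h.2

lemma Adm_context {w : Seq} {y z : List ℕ} (hz : Adm w z)
    (H : ∀ p, LeW (p ++ y) w → LeW (p ++ z) w) : ∀ P, Adm w (P ++ y) → Adm w (P ++ z) := by
  intro P
  induction P with
  | nil => intro _; exact hz
  | cons a P ih => intro h; exact ⟨H (a :: P) h.1, ih h.2⟩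

lemma LeW_lower {x z : ℕ} (hxz : z < x) (q q' : List ℕ) : ∀ (p : List ℕ) (w : Seq),
    LeW (p ++ x :: q) w → LeW (p ++ z :: q') w := by
  intro p
  induction p with
  | nil =>
    intro w h
    rcases h with h | ⟨h, _⟩
    · exact Or.inl (by omega)
    · exact Or.inl (by omega)
  | cons a p ih =>
    intro w h
    rcases h with h | ⟨h, h'⟩
    · exact Or.inl h
    · exact Or.inr ⟨h, ih _ h'⟩

lemma Adm_zeros {w : Seq} (h0 : 0 < w 0) {z : List ℕ} (hz : Adm w z) (j : ℕ) :
    Adm w (List.replicate j 0 ++ z) := by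
  induction j with
  | zero => exact hz
  | succ j ih => exact ⟨Or.inl h0, ih⟩

lemma seqLe_LeW : ∀ (r : ℕ) (v w : Seq), seqLe v w → LeW (pre v r) w := by
  intro r
  induction r with
  | zero => intros; trivial
  | succ r ih =>
    rintro v w (⟨s, h1, h2⟩ | rfl)
    · cases s with
      | zero => exact Or.inl h2
      | succ s =>
        exact Or.inr ⟨h1 0 (by omega), ih _ _ (Or.inl ⟨s, fun t ht => h1 (t + 1) (by omega), h2⟩)⟩
    · exact Or.inr ⟨rfl, ih _ _ (Or.inr rfl)⟩

lemma LeW_pre_le : ∀ (r : ℕ) (v w : Seq), (∀ s, s < r → v s = w s) → LeW (pre v (r + 1)) w →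
    v r ≤ w r := by
  intro r
  induction r with
  | zero =>
    rintro v w - (h | ⟨h, -⟩)
    · exact h.le
    · exact h.le
  | succ r ih =>
    rintro v w h1 (h | ⟨_, h⟩)
    · have := h1 0 (by omega); omega
    · exact ih (shift v) (shift w) (fun s hs => h1 (s + 1) (by omega)) h

lemma seqLe_iff (v w : Seq) : seqLe v w ↔ ∀ r, LeW (pre v r) w := by
  refine ⟨fun h r => seqLe_LeW r v w h, fun h => ?_⟩
  by_cases e : v = w
  · exact Or.inr e
  have : ∃ r, v r ≠ w r := by
    by_contra hc
    push Not at hc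
    exact e (funext hc)
  refine Or.inl ⟨Nat.find this, fun s hs => ?_, ?_⟩
  · by_contra hc; exact Nat.find_min this hs hc
  · have h1 := Nat.find_spec this
    have h2 := LeW_pre_le (Nat.find this) v w (fun s hs => by
      by_contra hc; exact Nat.find_min this hs hc) (h _)
    omega

lemma Adm_pre_of (w : Seq) : ∀ (r : ℕ) (v : Seq), (∀ j s, LeW (pre (shift^[j] v) s) w) →
    Adm w (pre v r) := by
  intro r
  induction r with
  | zero => intros; trivial
  | succ r ih =>
    intro v h
    exact ⟨h 0 (r + 1), ih _ fun j s => h (j + 1) s⟩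

lemma LeW_of_Adm_pre (w : Seq) : ∀ (j : ℕ) (v : Seq), (∀ r, Adm w (pre v r)) →
    ∀ s, LeW (pre (shift^[j] v) s) w := by
  intro j
  induction j with
  | zero => intro v h s; exact (h s).leW
  | succ j ih => intro v h s; exact ih (shift v) (fun r => (h (r + 1)).2) s

lemma mem_Xset {k : ℕ} (hk : 2 ≤ k) {v w : Seq} (hw : w 0 = k - 1) :
    v ∈ Xset k w ↔ ∀ r, Adm w (pre v r) := by
  constructor
  · rintro ⟨_, h⟩ r
    exact Adm_pre_of w r v fun j s => (seqLe_iff _ _).1 (h j) s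
  · intro h
    refine ⟨?_, fun r => (seqLe_iff _ _).2 (LeW_of_Adm_pre w r v h)⟩
    have : ∀ (r : ℕ) (v : Seq), (∀ r, Adm w (pre v r)) → v r < k := by
      intro r
      induction r with
      | zero =>
        intro v h
        rcases (h 1).1 with h | ⟨h, _⟩ <;> omega
      | succ r ih => intro v h; exact ih (shift v) fun r => (h (r + 1)).2
    exact fun r => this r v h

lemma pre_length : ∀ (r : ℕ) (v : Seq), (pre v r).length = r := by
  intro r
  induction r with
  | zero => intro v; rfl
  | succ r ih => intro v; simp [pre, ih]

lemma pre_add : ∀ (a b : ℕ) (v : Seq), pre v (a + b) = pre v a ++ pre (shift^[a] v) b := by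
  intro a
  induction a with
  | zero => intro b v; simp [pre]
  | succ a ih =>
    intro b v
    rw [show a + 1 + b = (a + b) + 1 by omega]
    simp [pre, ih]

lemma pre_app (l : List ℕ) (s : Seq) (r : ℕ) : pre (app l s) (l.length + r) = l ++ pre s r := by
  induction l with
  | nil => simp
  | cons a l ih =>
    rw [List.length_cons, show l.length + 1 + r = (l.length + r) + 1 by omega]
    simp [pre, ih]

lemma app_pre : ∀ (r : ℕ) (v : Seq), app (pre v r) (shift^[r] v) = v := by
  intro r
  induction r with
  | zero => intro v; rfl
  | succ r ih =>
    intro v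
    show consSeq _ (app (pre (shift v) r) (shift^[r] (shift v))) = v
    rw [ih]
    funext i
    cases i <;> rfl

lemma pre_congr : ∀ (r : ℕ) (v w : Seq), (∀ i, i < r → v i = w i) → pre v r = pre w r := by
  intro r
  induction r with
  | zero => intros; rfl
  | succ r ih =>
    intro v w h
    show v 0 :: _ = w 0 :: _
    rw [h 0 (by omega), ih (shift v) (shift w) fun i hi => h (i + 1) (by omega)]

lemma digitCount_eq (i : ℕ) : ∀ (r : ℕ) (v : Seq), digitCount v i r = (pre v r).count i := by
  intro r
  induction r with
  | zero => intro v; simp [digitCount, pre]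
  | succ r ih =>
    intro v
    have := ih (shift v)
    unfold digitCount at this ⊢
    rw [Finset.card_filter] at this ⊢
    rw [Finset.sum_range_succ']
    simp only [pre, List.count_cons, ← this, shift]
    by_cases h : v 0 = i <;> simp [h] <;> rw [Finset.card_filter] <;>
      exact Finset.sum_congr rfl fun _ _ => by congr

/-! ### Flattening -/

def flatSeq (b : ℕ → List ℕ) : Seq := fun m =>
  (((List.range (m + 1)).map b).flatten).getD m 0

def fl (b : ℕ → List ℕ) (N : ℕ) : List ℕ := ((List.range N).map b).flatten

lemma fl_succ (b : ℕ → List ℕ) (N : ℕ) : fl b (N + 1) = fl b N ++ b N := by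
  simp [fl, List.range_succ]

lemma fl_succ' (b : ℕ → List ℕ) (N : ℕ) : fl b (N + 1) = b 0 ++ fl (fun r => b (r + 1)) N := by
  simp [fl, List.range_succ_eq_map, Function.comp_def]

lemma fl_length (b : ℕ → List ℕ) (hb : ∀ r, b r ≠ []) (N : ℕ) : N ≤ (fl b N).length := by
  induction N with
  | zero => simp
  | succ N ih =>
    rw [fl_succ, List.length_append]
    have := List.length_pos_iff.2 (hb N)
    omega

lemma fl_getD (b : ℕ → List ℕ) (hb : ∀ r, b r ≠ []) (m N : ℕ) (h : m < (fl b N).length) :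
    (fl b N).getD m 0 = flatSeq b m := by
  have key : ∀ d A, m < (fl b A).length → (fl b (A + d)).getD m 0 = (fl b A).getD m 0 := by
    intro d
    induction d with
    | zero => intros; rfl
    | succ d ih =>
      intro A hA
      rw [← add_assoc, fl_succ, List.getD_append, ih A hA]
      by_contra hc
      have h1 : (fl b A).length ≤ (fl b (A + d)).length := by
        clear ih hc
        induction d with
        | zero => rfl
        | succ d ih => rw [← add_assoc, fl_succ, List.length_append]; omega
      omega
  show _ = (fl b (m + 1)).getD m 0
  have h2 : m < (fl b (m + 1)).length := fl_length b hb (m + 1)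
  rw [← key N (m + 1) h2, ← key (m + 1) N h, add_comm]

lemma flatSeq_app (b : ℕ → List ℕ) (hb : ∀ r, b r ≠ []) :
    flatSeq b = app (b 0) (flatSeq fun r => b (r + 1)) := by
  funext m
  have h2 : m < (fl b (m + 1)).length := fl_length b hb (m + 1)
  rw [← fl_getD b hb m (m + 1) h2, fl_succ']
  rw [fl_succ', List.length_append] at h2
  rcases lt_or_ge m (b 0).length with h | h
  · rw [app_lt _ _ _ h, List.getD_append _ _ _ _ h]
  · rw [app_ge _ _ _ h, List.getD_append_right _ _ _ _ h, fl_getD _ (fun r => hb (r + 1))]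
    omega

lemma flatSeq_app_fl (N : ℕ) : ∀ (b : ℕ → List ℕ), (∀ r, b r ≠ []) →
    flatSeq b = app (fl b N) (flatSeq fun r => b (r + N)) := by
  induction N with
  | zero => intro b hb; rfl
  | succ N ih =>
    intro b hb
    rw [flatSeq_app b hb, ih _ fun r => hb (r + 1), fl_succ', app_append]
    congr 2

/-! ### The substitution on words and sequences -/

def lamL (k m : ℕ) (u : List ℕ) : List ℕ := u.flatMap (lamWord k m)

@[simp] lemma lamL_nil (k m : ℕ) : lamL k m [] = [] := rfl
@[simp] lemma lamL_cons (k m a : ℕ) (u : List ℕ) : lamL k m (a :: u) = lamWord k m a ++ lamL k m u := by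
  simp [lamL]
@[simp] lemma lamL_append (k m : ℕ) (u v : List ℕ) : lamL k m (u ++ v) = lamL k m u ++ lamL k m v := by
  simp [lamL]

lemma lamWord_shape {k : ℕ} (hk : 2 ≤ k) (m a : ℕ) : ∃ x j, 0 < x ∧ x < k ∧ j ≤ m + 1 ∧
    lamWord k m a = x :: List.replicate j 0 := by
  unfold lamWord
  split_ifs
  · exact ⟨a + 1, 0, by omega, by omega, by omega, rfl⟩
  · exact ⟨k - 1, m + 1, by omega, by omega, by omega, rfl⟩
  · exact ⟨k - 1, m, by omega, by omega, by omega, rfl⟩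

lemma lamWord_ne {k : ℕ} (m a : ℕ) : lamWord k m a ≠ [] := by
  unfold lamWord
  split_ifs <;> simp

lemma lamWord_top {k : ℕ} (hk : 2 ≤ k) (m : ℕ) :
    lamWord k m (k - 1) = (k - 1) :: List.replicate m 0 := by
  unfold lamWord
  rw [if_neg (by omega), if_neg (by omega)]

lemma lamWord_pen {k : ℕ} (hk : 2 ≤ k) (m : ℕ) :
    lamWord k m (k - 2) = (k - 1) :: List.replicate (m + 1) 0 := by
  unfold lamWord
  rw [if_neg (by omega), if_pos (by omega)]

lemma lamWord_low {k : ℕ} (m a : ℕ) (h : a + 2 < k) : lamWord k m a = [a + 1] := by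
  unfold lamWord
  rw [if_pos h]

lemma lamSub_app (k m : ℕ) (w : Seq) :
    lamSub k m w = app (lamWord k m (w 0)) (lamSub k m (shift w)) :=
  flatSeq_app (fun r => lamWord k m (w r)) fun _ => lamWord_ne m _

lemma lamSub_app_pre (k m : ℕ) (r : ℕ) : ∀ w : Seq,
    lamSub k m w = app (lamL k m (pre w r)) (lamSub k m (shift^[r] w)) := by
  induction r with
  | zero => intro w; rfl
  | succ r ih =>
    intro w
    rw [lamSub_app, ih (shift w)]
    simp only [pre, lamL_cons, app_append]
    rfl

lemma lamSub_zero_pos {k : ℕ} (hk : 2 ≤ k) (m : ℕ) (w : Seq) : 0 < lamSub k m w 0 := by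
  rw [lamSub_app]
  obtain ⟨x, j, h1, h2, h3, h4⟩ := lamWord_shape hk m (w 0)
  rw [h4]; exact h1

lemma lamSub_top {k : ℕ} (hk : 2 ≤ k) (m : ℕ) (w : Seq) (h : w 0 = k - 1) :
    lamSub k m w = consSeq (k - 1) (app (List.replicate m 0) (lamSub k m (shift w))) := by
  rw [lamSub_app, h, lamWord_top hk]; rfl

lemma lamSub_top0 {k : ℕ} (hk : 2 ≤ k) (m : ℕ) (w : Seq) (h : w 0 = k - 1) :
    lamSub k m w 0 = k - 1 := by
  rw [lamSub_top hk m w h]; rfl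

lemma lamL_length (k m : ℕ) (u : List ℕ) : u.length ≤ (lamL k m u).length := by
  induction u with
  | nil => simp
  | cons a u ih =>
    have := List.length_pos_iff.2 (lamWord_ne (k := k) m a)
    simp only [lamL_cons, List.length_append, List.length_cons]
    omega

lemma lamSub_agree {k : ℕ} (hk : 2 ≤ k) (m p : ℕ) (v w : Seq) (h0 : v 0 = k - 1)
    (h : ∀ i, i < p + 1 → v i = w i) : ∀ i, i < p + 1 + m → lamSub k m v i = lamSub k m w i := by
  intro i hi
  have e := pre_congr (p + 1) v w h
  rw [lamSub_app_pre k m (p + 1) v, lamSub_app_pre k m (p + 1) w, ← e]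
  have hl : i < (lamL k m (pre v (p + 1))).length := by
    simp only [pre, lamL_cons, List.length_append, h0, lamWord_top hk, List.length_cons,
      List.length_replicate]
    have := lamL_length k m (pre (shift v) p)
    rw [pre_length] at this
    omega
  rw [app_lt _ _ _ hl, app_lt _ _ _ hl]

lemma lamSub_congr {k : ℕ} (m p : ℕ) (v w : Seq)
    (h : ∀ i, i < p + 1 → v i = w i) : lamSub k m v p = lamSub k m w p := by
  unfold lamSub
  congr 2
  apply List.map_congr_left
  intro r hr
  rw [h r (by simpa using hr)]

lemma lamChain_succ (k : ℕ) (r : ℕ) : ∀ (n : ℕ → ℕ) (w : Seq),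
    lamChain k n (r + 1) w = lamSub k (n 0) (lamChain k (sh n) r w) := by
  induction r with
  | zero => intro n w; rfl
  | succ r ih =>
    intro n w
    show lamChain k n (r + 1) (lamSub k (n (r + 2)) w) = _
    rw [ih]; rfl

lemma lamSub_zero_top {k : ℕ} (hk : 2 ≤ k) : lamSub k 0 (topSeq k) = topSeq k := by
  have h := lamSub_top hk 0 (topSeq k) rfl
  funext i
  induction i with
  | zero => rw [h]; rfl
  | succ i ih => rw [h]; exact ih

lemma lamChain_zero {k : ℕ} (hk : 2 ≤ k) (r : ℕ) : ∀ (n : ℕ → ℕ),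
    lamChain k n r (topSeq k) 0 = k - 1 := by
  induction r with
  | zero => intro n; exact lamSub_top0 hk _ _ rfl
  | succ r ih => intro n; rw [lamChain_succ]; exact lamSub_top0 hk _ _ (ih _)

lemma lamChain_agree {k : ℕ} (hk : 2 ≤ k) (r : ℕ) : ∀ (n : ℕ → ℕ) (i : ℕ),
    i < 1 + ∑ j ∈ Finset.range (r + 1), n j →
    lamChain k n r (topSeq k) i = lamChain k n (r + 1) (topSeq k) i := by
  induction r with
  | zero =>
    intro n i hi
    rw [lamChain_succ]
    refine lamSub_agree hk (n 0) 0 _ _ rfl ?_ i (by simpa using hi)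
    intro i hi
    have : i = 0 := by omega
    subst this
    exact (lamChain_zero hk 0 (sh n)).symm
  | succ r ih =>
    intro n i hi
    rw [lamChain_succ, lamChain_succ k (r + 1)]
    rw [Finset.sum_range_succ'] at hi
    refine lamSub_agree hk (n 0) (∑ j ∈ Finset.range (r + 1), n (j + 1)) _ _
      (lamChain_zero hk r _) ?_ i (by omega)
    intro i hi
    exact ih (sh n) i (by unfold sh; omega)

lemma lamChain_eventually {k : ℕ} (hk : 2 ≤ k) (n : ℕ → ℕ) (p : ℕ) :
    ∃ R, ∀ r, R ≤ r → lamChain k n r (topSeq k) p = lamChain k n R (topSeq k) p := by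
  set s : ℕ → ℕ := fun r => ∑ j ∈ Finset.range (r + 1), n j with hs
  obtain ⟨R, hR⟩ : ∃ R, ∀ r, p - s R ≤ p - s r := by
    have hne : ∃ y, ∃ r, p - s r = y := ⟨_, 0, rfl⟩
    obtain ⟨R, hR⟩ := Nat.find_spec hne
    exact ⟨R, fun r => by rw [hR]; exact Nat.find_min' hne ⟨r, rfl⟩⟩
  have hsucc : ∀ r, s (r + 1) = s r + n (r + 1) := fun r => Finset.sum_range_succ _ _
  have hmono : Monotone s := monotone_nat_of_le_succ fun r => by rw [hsucc]; omega
  refine ⟨R, fun r hr => ?_⟩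
  induction r, hr using Nat.le_induction with
  | base => rfl
  | succ r hr ih =>
    rw [← ih]
    rcases le_or_gt p (s r) with h | h
    · exact (lamChain_agree hk r n p (by change p < 1 + s r; omega)).symm
    · have h1 := hR (r + 1)
      have h2 := hmono hr
      have h3 := hsucc r
      have : n (r + 1) = 0 := by omega
      show lamChain k n r (lamSub k (n (r + 1)) (topSeq k)) p = _
      rw [this, lamSub_zero_top hk]

lemma Sseq_eventually {k : ℕ} (hk : 2 ≤ k) (n : ℕ → ℕ) (p : ℕ) :
    ∃ R, ∀ r, R ≤ r → lamChain k n r (topSeq k) p = Sseq k n p := by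
  choose R hR using lamChain_eventually hk n
  have hT : Tendsto (fun r => lamChain k n r (topSeq k)) atTop
      (𝓝 fun p => lamChain k n (R p) (topSeq k) p) := by
    rw [tendsto_pi_nhds]
    intro p
    apply tendsto_const_nhds.congr'
    filter_upwards [eventually_ge_atTop (R p)] with r hr
    exact (hR p r hr).symm
  have : Sseq k n = fun p => lamChain k n (R p) (topSeq k) p := hT.limUnder_eq
  refine ⟨R p, fun r hr => ?_⟩
  rw [this]; exact hR p r hr

lemma Sseq_zero {k : ℕ} (hk : 2 ≤ k) (n : ℕ → ℕ) : Sseq k n 0 = k - 1 := by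
  obtain ⟨R, hR⟩ := Sseq_eventually hk n 0
  rw [← hR R le_rfl, lamChain_zero hk]

lemma Sseq_eq {k : ℕ} (hk : 2 ≤ k) (n : ℕ → ℕ) :
    Sseq k n = lamSub k (n 0) (Sseq k (sh n)) := by
  funext p
  choose R hR using Sseq_eventually hk (sh n)
  obtain ⟨Q, hQ⟩ := Sseq_eventually hk n p
  set T := Q + ∑ i ∈ Finset.range (p + 1), R i with hT
  rw [← hQ (T + 1) (by omega), lamChain_succ]
  apply lamSub_congr
  intro i hi
  apply hR
  have : R i ≤ ∑ i ∈ Finset.range (p + 1), R i :=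
    Finset.single_le_sum (f := R) (fun _ _ => Nat.zero_le _) (Finset.mem_range.2 hi)
  omega

lemma lamSub_lt {k : ℕ} (hk : 2 ≤ k) (m : ℕ) (p : ℕ) : ∀ (w : Seq), lamSub k m w p < k := by
  induction p using Nat.strong_induction_on with
  | _ p ih =>
  intro w
  rw [lamSub_app]
  obtain ⟨x, j, h1, h2, h3, h4⟩ := lamWord_shape hk m (w 0)
  rcases lt_or_ge p (lamWord k m (w 0)).length with h | h
  · rw [app_lt _ _ _ h, h4]
    cases p with
    | zero => exact h2
    | succ p =>
      have : (List.replicate j 0).getD p 0 = 0 := by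
        simp only [List.getD_eq_getElem?_getD, List.getElem?_replicate]
        split_ifs <;> rfl
      simp only [List.getD_cons_succ, this]; omega
  · rw [app_ge _ _ _ h]
    apply ih
    have := List.length_pos_iff.2 (lamWord_ne (k := k) m (w 0))
    omega

lemma Sseq_lt {k : ℕ} (hk : 2 ≤ k) (n : ℕ → ℕ) (p : ℕ) : Sseq k n p < k := by
  rw [Sseq_eq hk]; exact lamSub_lt hk _ _ _

/-- zero runs in images of the substitution are bounded -/
lemma lamSub_run {k : ℕ} (hk : 2 ≤ k) (m : ℕ) (p : ℕ) : ∀ (w : Seq),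
    ∃ i, i < m + 3 ∧ lamSub k m w (p + i) ≠ 0 := by
  induction p using Nat.strong_induction_on with
  | _ p ih =>
  intro w
  rw [lamSub_app]
  obtain ⟨x, j, h1, h2, h3, h4⟩ := lamWord_shape hk m (w 0)
  have hl : (lamWord k m (w 0)).length = j + 1 := by rw [h4]; simp
  rcases lt_or_ge p (j + 1) with h | h
  · refine ⟨j + 1 - p, by omega, ?_⟩
    rw [app_ge _ _ _ (by omega), hl, show p + (j + 1 - p) - (j + 1) = 0 by omega]
    exact (lamSub_zero_pos hk m _).ne'
  · obtain ⟨i, hi, hi'⟩ := ih (p - (j + 1)) (by omega) (shift w)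
    refine ⟨i, hi, ?_⟩
    rw [app_ge _ _ _ (by omega), hl, show p + i - (j + 1) = p - (j + 1) + i by omega]
    exact hi'

/-! ### The substitution and admissibility -/

lemma LeW_zeros_lt {s : Seq} (hs : 0 < s 0) (m : ℕ) (q : List ℕ) :
    LeW (List.replicate (m + 1) 0 ++ q) (app (List.replicate m 0) s) := by
  rw [List.replicate_succ', List.append_assoc, LeW_app]
  exact Or.inl hs

/-- `(k-1)0^{m+1}` is strictly below `Λ_m w`. -/
lemma LeW_pen {k : ℕ} (hk : 2 ≤ k) (m : ℕ) {w : Seq} (h0 : w 0 = k - 1) (q : List ℕ) :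
    LeW (lamWord k m (k - 2) ++ q) (lamSub k m w) := by
  rw [lamSub_top hk m w h0, lamWord_pen hk]
  exact Or.inr ⟨rfl, LeW_zeros_lt (lamSub_zero_pos hk _ _) m q⟩

lemma LeW_lam {k : ℕ} (hk : 2 ≤ k) (m : ℕ) : ∀ (u : List ℕ) (w : Seq), (∀ r, w r < k) → LeW u w →
    LeW (lamL k m u) (lamSub k m w) := by
  intro u
  induction u with
  | nil => intros; trivial
  | cons a u ih =>
    intro w hw h
    rw [lamL_cons]
    rcases h with h | ⟨h, h'⟩
    · have hb := hw 0
      by_cases h2 : a + 2 < k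
      · rw [lamWord_low _ _ h2]
        refine Or.inl ?_
        rw [lamSub_app]
        by_cases h3 : w 0 + 2 < k
        · rw [lamWord_low _ _ h3]; show a + 1 < w 0 + 1; omega
        · have : lamWord k m (w 0) = (k - 1) :: (lamWord k m (w 0)).tail := by
            unfold lamWord
            rw [if_neg h3]; split_ifs <;> rfl
          rw [this]; show a + 1 < k - 1; omega
      · have ha : a = k - 2 := by omega
        rw [ha]
        exact LeW_pen hk m (by omega) _
    · rw [lamSub_app, ← h, LeW_app]
      exact ih _ (fun r => hw (r + 1)) h'

lemma Adm_lam {k : ℕ} (hk : 2 ≤ k) (m : ℕ) {w : Seq} (hw : ∀ r, w r < k) (h0 : w 0 = k - 1) :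
    ∀ {u : List ℕ}, Adm w u → Adm (lamSub k m w) (lamL k m u) := by
  intro u
  induction u with
  | nil => intros; trivial
  | cons a u ih =>
    intro h
    have h1 := LeW_lam hk m _ _ hw h.1
    rw [lamL_cons] at h1 ⊢
    obtain ⟨x, j, _, _, _, h4⟩ := lamWord_shape hk m a
    rw [h4] at h1 ⊢
    exact ⟨h1, Adm_zeros (lamSub_zero_pos hk _ _) (ih h.2) j⟩

lemma LeW_unlam {k : ℕ} (hk : 2 ≤ k) (m x : ℕ) : ∀ (u : List ℕ) (w : Seq), (∀ a ∈ u, a < k) →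
    (∀ r, w r < k) →
    LeW (lamL k m (u ++ [x])) (lamSub k m w) → LeW u w := by
  intro u
  induction u with
  | nil => intros; trivial
  | cons a u ih =>
    intro w hu hw h
    have ha : a < k := hu a (by simp)
    have hb := hw 0
    rw [List.cons_append, lamL_cons, lamSub_app] at h
    rcases lt_trichotomy a (w 0) with hab | hab | hab
    · exact Or.inl hab
    · refine Or.inr ⟨hab, ?_⟩
      rw [← hab, LeW_app] at h
      exact ih _ (fun a ha => hu a (by simp [ha])) (fun r => hw (r + 1)) h
    · exfalso
      by_cases h3 : w 0 + 2 < k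
      · rw [lamWord_low _ _ h3] at h
        have : ∃ y t, lamWord k m a = y :: t ∧ w 0 + 1 < y := by
          unfold lamWord
          split_ifs
          · exact ⟨_, _, rfl, by omega⟩
          · exact ⟨_, _, rfl, by omega⟩
          · exact ⟨_, _, rfl, by omega⟩
        obtain ⟨y, t, e, hy⟩ := this
        rw [e] at h
        rcases h with h | ⟨h, _⟩
        · have h' : y < w 0 + 1 := h
          omega
        · have h' : y = w 0 + 1 := h
          omega
      · have e1 : a = k - 1 := by omega
        have e2 : w 0 = k - 2 := by omega
        rw [e1, e2, lamWord_top hk, lamWord_pen hk, List.replicate_succ', ← List.cons_append,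
          app_append, LeW_app] at h
        obtain ⟨y, t, e, hy⟩ : ∃ y t, lamL k m (u ++ [x]) = y :: t ∧ 0 < y := by
          cases u with
          | nil =>
            obtain ⟨y, j, h1, _, _, h4⟩ := lamWord_shape hk m x
            exact ⟨y, List.replicate j 0, by simp [h4], h1⟩
          | cons b u =>
            obtain ⟨y, j, h1, _, _, h4⟩ := lamWord_shape hk m b
            exact ⟨y, _, by rw [List.cons_append, lamL_cons, h4, List.cons_append], h1⟩
        rw [e] at h
        rcases h with h | ⟨h, _⟩
        · have h' : y < 0 := h
          omega
        · have h' : y = 0 := h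
          omega

lemma Adm_unlam {k : ℕ} (hk : 2 ≤ k) (m x : ℕ) {w : Seq} (hw : ∀ r, w r < k) :
    ∀ (u : List ℕ), (∀ a ∈ u, a < k) →
    Adm (lamSub k m w) (lamL k m (u ++ [x])) → Adm w u := by
  intro u
  induction u with
  | nil => intros; trivial
  | cons a u ih =>
    intro hu h
    refine ⟨LeW_unlam hk m x _ _ hu hw h.leW, ih (fun a ha => hu a (by simp [ha])) ?_⟩
    rw [List.cons_append, lamL_cons] at h
    exact Adm_suffix h

/-- words without the letter `k-1` are unconstrained -/
lemma Adm_low {k : ℕ} (hk : 2 ≤ k) (m : ℕ) {w : Seq} (h0 : w 0 = k - 1) {r : List ℕ}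
    (hr : Adm (lamSub k m w) r) : ∀ (b : List ℕ), (∀ a ∈ b, a < k - 1) →
    Adm (lamSub k m w) (lamL k m b ++ r) := by
  intro b
  induction b with
  | nil => intro _; exact hr
  | cons a b ih =>
    intro hb
    have ha : a < k - 1 := hb a (by simp)
    have ih' := ih fun a ha => hb a (by simp [ha])
    have hpos := lamSub_zero_pos hk m w
    rw [lamL_cons, List.append_assoc]
    have h1 : LeW (lamWord k m a ++ (lamL k m b ++ r)) (lamSub k m w) := by
      by_cases h2 : a + 2 < k
      · rw [lamWord_low _ _ h2]
        refine Or.inl ?_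
        rw [lamSub_top0 hk m w h0]; omega
      · have : a = k - 2 := by omega
        rw [this]; exact LeW_pen hk m h0 _
    obtain ⟨x, j, _, _, _, h4⟩ := lamWord_shape hk m a
    rw [h4] at h1 ⊢
    exact ⟨h1, Adm_zeros hpos ih' j⟩

/-! ### Count vectors -/

noncomputable def cvec (k : ℕ) (l : List ℕ) : E k :=
  (WithLp.equiv 2 (Fin k → ℝ)).symm fun i => (l.count (i : ℕ) : ℝ)

lemma proj_cvec {k : ℕ} (l : List ℕ) (i : ℕ) (h : i < k) : proj (cvec k l) i = l.count i := by
  unfold cvec; rw [proj_mk _ _ h]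

lemma cvec_append {k : ℕ} (l t : List ℕ) : cvec k (l ++ t) = cvec k l + cvec k t := by
  apply proj_ext; intro i hi
  rw [proj_add, proj_cvec _ _ hi, proj_cvec _ _ hi, proj_cvec _ _ hi, List.count_append]
  push_cast; rfl

lemma cvec_nil {k : ℕ} : cvec k [] = 0 := by
  apply proj_ext; intro i hi
  rw [proj_zero, proj_cvec _ _ hi]; simp

lemma cvec_cons {k : ℕ} (a : ℕ) (t : List ℕ) : cvec k (a :: t) = cvec k [a] + cvec k t := by
  rw [← cvec_append]; rfl

lemma cvec_single {k : ℕ} (a : ℕ) : cvec k [a] = evec k a := by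
  apply proj_ext; intro i hi
  rw [proj_cvec _ _ hi, proj_evec _ _ hi, List.count_singleton]
  by_cases h : i = a
  · simp [h]
  · have h' : ¬ a = i := fun e => h e.symm
    simp [h, h']

lemma NN0_cvec {k : ℕ} (l : List ℕ) : NN0 (cvec k l) := fun i hi => by
  rw [proj_cvec _ _ hi]; positivity

lemma cvec_replicate {k : ℕ} (a j : ℕ) : cvec k (List.replicate j a) = (j : ℝ) • evec k a := by
  induction j with
  | zero => simp [cvec_nil]
  | succ j ih =>
    rw [List.replicate_succ, cvec_cons, ih, cvec_single]
    push_cast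
    rw [add_smul, one_smul, add_comm]

lemma vsum_evec_le {k : ℕ} (a : ℕ) : vsum (evec k a) ≤ 1 := by
  by_cases h : a < k
  · rw [vsum_evec a h]
  · have : vsum (evec k a) = 0 := by
      apply Finset.sum_eq_zero
      intro i hi
      have hi := Finset.mem_range.1 hi
      rw [proj_evec _ _ hi, if_neg (by omega)]
    rw [this]; norm_num

lemma vsum_zero {k : ℕ} : vsum (0 : E k) = 0 := by
  have := vsum_smul (0 : ℝ) (0 : E k)
  simpa using this

lemma vsum_cvec_le {k : ℕ} (l : List ℕ) : vsum (cvec k l) ≤ l.length := by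
  induction l with
  | nil => rw [cvec_nil, vsum_zero]; simp
  | cons a l ih =>
    rw [cvec_cons, vsum_add, cvec_single]
    have := vsum_evec_le (k := k) a
    push_cast [List.length_cons]
    linarith

lemma cvec_lamWord {k : ℕ} (hk : 2 ≤ k) (m a : ℕ) (ha : a < k) :
    cvec k (lamWord k m a) = Mv m (evec k a) := by
  apply proj_ext; intro i hi
  rw [proj_cvec _ _ hi, proj_Mv _ _ _ hi, proj_evec _ _ (by omega : k - 2 < k),
    proj_evec _ _ (by omega : k - 1 < k), proj_evec _ _ (by omega : i - 1 < k)]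
  by_cases h1 : a + 2 < k
  · rw [lamWord_low _ _ h1, List.count_singleton]
    by_cases h0 : i = 0
    · subst h0
      rw [if_pos rfl, if_neg (by omega : ¬ k - 2 = a), if_neg (by omega : ¬ k - 1 = a)]; simp
    · have e : (a + 1 = i) ↔ (i - 1 = a) := by omega
      simp only [beq_iff_eq, e, h0, if_false]
      by_cases h2 : i + 1 = k
      · rw [if_pos h2, if_neg (by omega), if_neg (by omega), if_neg (by omega)]; simp
      · rw [if_neg h2]; split_ifs <;> simp
  by_cases h2 : a = k - 2
  · subst h2
    rw [lamWord_pen hk, List.count_cons, List.count_replicate]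
    by_cases h0 : i = 0
    · subst h0
      rw [if_pos rfl]
      have : ¬ (k - 1 = k - 2) := by omega
      have h' : ¬ (k - 1 = 0) := by omega
      simp [this, h']
    · have h0' : ¬ (0 = i) := fun h => h0 h.symm
      have : ¬ (k - 1 = k - 2) := by omega
      by_cases h3 : i + 1 = k
      · have : k - 1 = i := by omega
        simp [h0, h0', h3, this]; omega
      · have h4 : ¬ k - 1 = i := by omega
        have h5 : ¬ i - 1 = k - 2 := by omega
        simp [h0, h0', h3, h4, h5]
  · have h3 : a = k - 1 := by omega
    subst h3
    rw [lamWord_top hk, List.count_cons, List.count_replicate]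
    have g : ¬ (k - 2 = k - 1) := by omega
    by_cases h0 : i = 0
    · subst h0
      have h' : ¬ (k - 1 = 0) := by omega
      simp [g, h']
    · have h0' : ¬ (0 = i) := fun h => h0 h.symm
      by_cases h3 : i + 1 = k
      · have : k - 1 = i := by omega
        simp [h0, h0', h3, this]; omega
      · have h4 : ¬ k - 1 = i := by omega
        have h5 : ¬ i - 1 = k - 1 := by omega
        simp [h0, h0', h3, h4, h5]

lemma cvec_lamL {k : ℕ} (hk : 2 ≤ k) (m : ℕ) (u : List ℕ) (hu : ∀ a ∈ u, a < k) :
    cvec k (lamL k m u) = Mv m (cvec k u) := by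
  induction u with
  | nil =>
    rw [lamL_nil, cvec_nil]
    have := Mv_smul m (0 : ℝ) (0 : E k)
    simpa using this.symm
  | cons a u ih =>
    rw [lamL_cons, cvec_append, cvec_cons, Mv_add, cvec_lamWord hk m a (hu a (by simp)),
      ih fun a ha => hu a (by simp [ha]), cvec_single]

/-! ### Upper bound -/

lemma LeW_zero_split (m : ℕ) (s : Seq) : ∀ (r : List ℕ), LeW r (app (List.replicate m 0) s) →
    r.length < m ∨ ∃ r', r = List.replicate m 0 ++ r' := by
  induction m with
  | zero => intro r _; exact Or.inr ⟨r, rfl⟩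
  | succ m ih =>
    intro r h
    cases r with
    | nil => left; simp
    | cons a r =>
      rcases h with h | ⟨h, h'⟩
      · exact absurd h (by simp [List.replicate_succ])
      · have ha : a = 0 := h
        rcases ih r h' with h1 | ⟨r', h1⟩
        · left; simpa using h1
        · right; exact ⟨r', by rw [ha, h1]; rfl⟩

lemma last_split (x : ℕ) (l : List ℕ) (h : x ∈ l) : ∃ a b, l = a ++ x :: b ∧ x ∉ b := by
  induction l with
  | nil => simp at h
  | cons y l ih =>
    by_cases hl : x ∈ l
    · obtain ⟨a, b, e, hb⟩ := ih hl
      exact ⟨y :: a, b, by rw [e]; rfl, hb⟩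
    · have : x = y := by simpa [hl] using h
      exact ⟨[], l, by rw [this]; rfl, hl⟩

lemma process {k : ℕ} (hk : 2 ≤ k) (m : ℕ) {w : Seq} (h0 : w 0 = k - 1) (N : ℕ) :
    ∀ (rest : List ℕ), rest.length ≤ N → ∀ u : List ℕ, (∀ a ∈ u, a < k) →
    Adm (lamSub k m w) (lamL k m u ++ rest) →
    ∃ (c : E k) (u' e : List ℕ), (∀ a ∈ u', a < k) ∧ NN0 c ∧ TT m c ∧
      Adm (lamSub k m w) (lamL k m u') ∧ e.length ≤ m + 1 ∧
      cvec k (lamL k m u ++ rest) = c + cvec k (lamL k m u') + cvec k e := by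
  have hz : NN0 (0 : E k) := fun i _ => by rw [proj_zero]
  have hzT : TT m (0 : E k) := by unfold TT; rw [proj_zero, proj_zero]; simp
  have hW0 := lamSub_top0 hk m w h0
  have hWpos := lamSub_zero_pos hk m w
  induction N with
  | zero =>
    intro rest hr u hu h
    have : rest = [] := List.length_eq_zero_iff.1 (by omega)
    subst this
    exact ⟨0, u, [], hu, hz, hzT, by simpa using h, by simp, by simp [cvec_nil]⟩
  | succ N ih =>
    intro rest hr u hu h
    cases rest with
    | nil => exact ⟨0, u, [], hu, hz, hzT, by simpa using h, by simp, by simp [cvec_nil]⟩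
    | cons x r =>
      have hr' : r.length ≤ N := by simpa using hr
      have hx := (Adm_suffix h).1
      have hxk : x ≤ k - 1 := by
        rcases hx with hx | ⟨hx, _⟩ <;> omega
      by_cases hx0 : x = 0
      · subst hx0
        by_cases hmem : k - 1 ∈ u
        · obtain ⟨a, b, rfl, hb⟩ := last_split _ _ hmem
          have hbk : ∀ y ∈ b, y < k - 1 := by
            intro y hy
            have h1 := hu y (by simp [hy])
            have h2 : y ≠ k - 1 := fun e => hb (e ▸ hy)
            omega
          have hu2 : ∀ y ∈ a ++ (k - 2) :: b, y < k := by
            intro y hy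
            rcases List.mem_append.1 hy with hy | hy
            · exact hu y (by simp [hy])
            · rcases List.mem_cons.1 hy with hy | hy
              · omega
              · exact hu y (by simp [hy])
          have e1 : lamL k m (a ++ (k - 1) :: b) ++ 0 :: r =
              (lamL k m a ++ (k - 1) :: List.replicate m 0) ++ (lamL k m b ++ 0 :: r) := by
            simp [lamWord_top hk]
          have e2 : lamL k m (a ++ (k - 2) :: b) ++ r =
              (lamL k m a ++ (k - 1) :: List.replicate m 0) ++ (0 :: (lamL k m b ++ r)) := by
            simp [lamWord_pen hk, List.replicate_succ']
          have hA : Adm (lamSub k m w) (lamL k m (a ++ (k - 2) :: b) ++ r) := by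
            rw [e1] at h
            rw [e2]
            have hr2 : Adm (lamSub k m w) r := by
              have := Adm_suffix (Adm_suffix h)
              exact this.2
            have h1 : Adm (lamSub k m w) (0 :: (lamL k m b ++ r)) :=
              ⟨Or.inl hWpos, Adm_low hk m h0 hr2 b hbk⟩
            refine Adm_context h1 ?_ _ h
            intro p hp
            cases b with
            | nil => simpa using hp
            | cons y b =>
              obtain ⟨z, j, hz1, _, _, hz4⟩ := lamWord_shape hk m y
              rw [lamL_cons, hz4] at hp
              exact LeW_lower hz1 _ _ p _ hp
          obtain ⟨c, u', e, k1, k2, k3, k4, k5, k6⟩ := ih r hr' _ hu2 hA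
          refine ⟨c, u', e, k1, k2, k3, k4, k5, ?_⟩
          rw [← k6, e1, e2]
          rw [cvec_append, cvec_append _ (0 :: r), cvec_append _ (0 :: (lamL k m b ++ r)),
            cvec_cons 0 r, cvec_cons 0 (lamL k m b ++ r), cvec_append _ r]
          abel
        · have hA : Adm (lamSub k m w) (lamL k m [] ++ r) := (Adm_suffix h).2
          obtain ⟨c, u', e, k1, k2, k3, k4, k5, k6⟩ := ih r hr' [] (by simp) hA
          refine ⟨cvec k (lamL k m u ++ [0]) + c, u', e, k1, (NN0_cvec _).add k2, ?_, k4, k5, ?_⟩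
          · unfold TT at k3 ⊢
            rw [proj_add, proj_add, cvec_append, proj_add, proj_add, cvec_lamL hk m u hu,
              Mv_last hk, Mv_zero hk, proj_cvec u (k - 1) (by omega), List.count_eq_zero.2 hmem,
              proj_cvec [0] (k - 1) (by omega), proj_cvec [0] 0 (by omega)]
            have : ¬ (0 = k - 1) := by omega
            simp [this]
            linarith
          · have : lamL k m u ++ 0 :: r = (lamL k m u ++ [0]) ++ r := by simp
            rw [lamL_nil, List.nil_append] at k6
            rw [this, cvec_append _ r, k6]
            abel
      by_cases hx1 : x = k - 1
      · subst hx1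
        have hr2 : LeW r (app (List.replicate m 0) (lamSub k m (shift w))) := by
          rw [lamSub_top hk m w h0] at hx
          rcases hx with hx | ⟨_, hx⟩
          · exact absurd hx (by simp)
          · exact hx
        rcases LeW_zero_split m _ r hr2 with hlen | ⟨r', rfl⟩
        · refine ⟨0, u, (k - 1) :: r, hu, hz, hzT, Adm_prefix h, by simp; omega, ?_⟩
          rw [cvec_append, zero_add]
        · have e1 : lamL k m u ++ (k - 1) :: (List.replicate m 0 ++ r') =
              lamL k m (u ++ [k - 1]) ++ r' := by
            simp [lamWord_top hk]
          rw [e1] at h ⊢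
          refine ih r' ?_ _ ?_ h
          · rw [List.length_append] at hr'; omega
          · intro y hy
            rcases List.mem_append.1 hy with hy | hy
            · exact hu y hy
            · have : y = k - 1 := by simpa using hy
              omega
      · have e1 : lamL k m u ++ x :: r = lamL k m (u ++ [x - 1]) ++ r := by
          rw [lamL_append, lamL_cons, lamWord_low _ _ (by omega : x - 1 + 2 < k)]
          simp; omega
        rw [e1] at h ⊢
        refine ih r hr' _ ?_ h
        intro y hy
        rcases List.mem_append.1 hy with hy | hy
        · exact hu y hy
        · have : y = x - 1 := by simpa using hy
          omega

lemma vsum_Mv_le {k : ℕ} (hk : 2 ≤ k) (m : ℕ) {c : E k} (h : NN0 c) :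
    vsum (Mv m c) ≤ ((m : ℝ) + 2) * vsum c := by
  rw [vsum_Mv hk]
  obtain ⟨d, rfl⟩ : ∃ d, k = d + 2 := ⟨k - 2, by omega⟩
  have h1 : 0 ≤ ∑ i ∈ Finset.range d, proj c i :=
    Finset.sum_nonneg fun i hi => h i (by have := Finset.mem_range.1 hi; omega)
  have h2 := h d (by omega)
  have h3 := h (d + 1) (by omega)
  have e : vsum c = ∑ i ∈ Finset.range d, proj c i + proj c d + proj c (d + 1) := by
    unfold vsum; rw [Finset.sum_range_succ, Finset.sum_range_succ]
  simp only [show d + 2 - 2 = d by omega, show d + 2 - 1 = d + 1 by omega]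
  have hm : (0 : ℝ) ≤ m := by positivity
  nlinarith [mul_nonneg hm h1]

lemma upper {k : ℕ} (hk : 2 ≤ k) (R : ℕ) : ∀ n : ℕ → ℕ, ∃ C : ℝ, ∀ u : List ℕ, Adm (Sseq k n) u →
    ∃ d e : E k, cvec k u = d + e ∧ DD R n d ∧ NN0 e ∧ vsum e ≤ C := by
  induction R with
  | zero =>
    intro n
    refine ⟨0, fun u _ => ⟨cvec k u, 0, by simp, NN0_cvec u, fun i _ => by rw [proj_zero], ?_⟩⟩
    rw [vsum_zero]
  | succ R ih =>
    intro n
    obtain ⟨C, hC⟩ := ih (sh n)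
    set m := n 0 with hm
    refine ⟨((m : ℝ) + 2) * C + (m + 2) + (m + 1), fun u hu => ?_⟩
    rw [Sseq_eq hk n] at hu
    obtain ⟨c, u', e, k1, k2, k3, k4, k5, k6⟩ :=
      process hk m (Sseq_zero hk (sh n)) u.length u le_rfl [] (by simp) (by simpa using hu)
    rw [lamL_nil, List.nil_append] at k6
    obtain ⟨u0, x, hx⟩ : ∃ u0 x : List ℕ, u' = u0 ++ x ∧ x.length ≤ 1 ∧ Adm (Sseq k (sh n)) u0 := by
      rcases List.eq_nil_or_concat u' with h | ⟨u0, x, h⟩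
      · exact ⟨[], [], by simp [h], by simp, trivial⟩
      · rw [List.concat_eq_append] at h
        refine ⟨u0, [x], h, by simp, ?_⟩
        refine Adm_unlam hk m x (Sseq_lt hk _) u0 (fun a ha => k1 a (by simp [h, ha])) ?_
        rw [← h]; exact k4
    obtain ⟨rfl, hx1, hx2⟩ := hx
    obtain ⟨d, e0, j1, j2, j3, j4⟩ := hC u0 hx2
    have hxk : ∀ a ∈ x, a < k := fun a ha => k1 a (by simp [ha])
    have hN : NN0 (Mv m (cvec k x)) := NN0_Mv hk m (NN0_cvec x)
    refine ⟨c + Mv m d, Mv m e0 + Mv m (cvec k x) + cvec k e, ?_, ?_, ?_, ?_⟩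
    · rw [k6, cvec_lamL hk m _ k1, cvec_append, j1, Mv_add, Mv_add]; abel
    · refine DD_add hk _ _ _ _ (DD_of_TT k2 k3) ⟨NN0_Mv hk m j2.nn, Or.inr ?_⟩
      rw [← hm, Mi_Mv hk]; exact j2
    · exact ((NN0_Mv hk m j3).add hN).add (NN0_cvec e)
    · rw [vsum_add, vsum_add]
      have h1 := vsum_Mv_le hk m j3
      have h2 := vsum_Mv_le hk m (NN0_cvec (k := k) x)
      have h3 := vsum_cvec_le (k := k) x
      have h4 := vsum_cvec_le (k := k) e
      have h5 : (x.length : ℝ) ≤ 1 := by exact_mod_cast hx1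
      have h6 : (e.length : ℝ) ≤ m + 1 := by exact_mod_cast k5
      have hm0 : (0 : ℝ) ≤ m := by positivity
      have h7 : ((m : ℝ) + 2) * vsum e0 ≤ (m + 2) * C :=
        mul_le_mul_of_nonneg_left j4 (by linarith)
      have h8 : ((m : ℝ) + 2) * vsum (cvec k x) ≤ (m + 2) * 1 :=
        mul_le_mul_of_nonneg_left (by linarith) (by linarith)
      linarith

lemma tendsto_of_proj {k : ℕ} {f : ℕ → E k} {a : E k}
    (h : ∀ i, i < k → Tendsto (fun r => proj (f r) i) atTop (𝓝 (proj a i))) :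
    Tendsto f atTop (𝓝 a) := by
  have h2 : Tendsto (fun r => (WithLp.equiv 2 (Fin k → ℝ)) (f r)) atTop
      (𝓝 ((WithLp.equiv 2 (Fin k → ℝ)) a)) := by
    rw [tendsto_pi_nhds]
    intro i
    have := h i i.2
    simpa [proj] using this
  have h3 := ((PiLp.continuous_toLp 2 (fun _ : Fin k => ℝ)).tendsto _).comp h2
  exact h3

lemma NN0.le_vsum {k : ℕ} {e : E k} (h : NN0 e) {i : ℕ} (hi : i < k) : proj e i ≤ vsum e :=
  Finset.single_le_sum (f := fun i => proj e i) (fun i hi => h i (Finset.mem_range.1 hi))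
    (Finset.mem_range.2 hi)

lemma DFn_sub {k : ℕ} (hk : 2 ≤ k) (n : ℕ → ℕ) {α : E k} (h : α ∈ DFn k n) :
    α ∈ simplex k ∧ GG n α := by
  obtain ⟨h1, v, hv, hf⟩ := h
  refine ⟨h1, fun R => ?_⟩
  rw [mem_Xset hk (Sseq_zero hk n)] at hv
  obtain ⟨C, hC⟩ := upper hk R n
  choose d e k1 k2 k3 k4 using fun r => hC _ (hv r)
  have hlim : Tendsto (fun r : ℕ => ((r : ℝ)⁻¹) • d r) atTop (𝓝 α) := by
    apply tendsto_of_proj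
    intro i hi
    have he : Tendsto (fun r : ℕ => (r : ℝ)⁻¹ * proj (e r) i) atTop (𝓝 0) := by
      have hC0 : Tendsto (fun r : ℕ => (r : ℝ)⁻¹ * C) atTop (𝓝 0) := by
        have := (tendsto_inv_atTop_nhds_zero_nat (𝕜 := ℝ)).mul_const C
        simpa using this
      refine squeeze_zero (fun r => ?_) (fun r => ?_) hC0
      · exact mul_nonneg (by positivity) (k3 r i hi)
      · exact mul_le_mul_of_nonneg_left (((k3 r).le_vsum hi).trans (k4 r)) (by positivity)
    have := (hf i hi).sub he
    rw [sub_zero] at this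
    refine this.congr fun r => ?_
    have e1 := congrArg (fun c => proj c i) (k1 r)
    simp only [proj_add, proj_cvec _ _ hi] at e1
    rw [digitCount_eq, e1, proj_smul]
    ring
  refine (isClosed_DD R n).mem_of_tendsto hlim (Eventually.of_forall fun r => ?_)
  exact DD_smul R n _ (k2 r) _ (by positivity)

/-! ### Lower bound: asymptotically realisable vectors -/

lemma LeW_zero_any (L : ℕ) : ∀ w : Seq, LeW (List.replicate L 0) w := by
  induction L with
  | zero => intros; trivial
  | succ L ih =>
    intro w
    rcases Nat.eq_zero_or_pos (w 0) with h | h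
    · exact Or.inr ⟨h.symm, ih _⟩
    · exact Or.inl h

lemma LeW_pad (L : ℕ) : ∀ (p : List ℕ) (w : Seq), LeW p w → LeW (p ++ List.replicate L 0) w := by
  intro p
  induction p with
  | nil => intro w _; exact LeW_zero_any L w
  | cons a p ih =>
    intro w h
    rcases h with h | ⟨h, h'⟩
    · exact Or.inl h
    · exact Or.inr ⟨h, ih _ h'⟩

lemma Adm_pad {w : Seq} (h0 : 0 < w 0) (L : ℕ) {u : List ℕ} (h : Adm w u) :
    Adm w (u ++ List.replicate L 0) := by
  refine Adm_context (y := []) ?_ ?_ u (by simpa using h)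
  · have := Adm_zeros (w := w) h0 (z := []) trivial L
    simpa using this
  · intro p hp
    exact LeW_pad L p w (by simpa using hp)

lemma LeW_zero_run (N : ℕ) (v : List ℕ) : ∀ w : Seq, (∃ i, i < N ∧ w i ≠ 0) →
    LeW (List.replicate N 0 ++ v) w := by
  induction N with
  | zero => rintro w ⟨i, hi, _⟩; omega
  | succ N ih =>
    rintro w ⟨i, hi, h⟩
    rcases Nat.eq_zero_or_pos (w 0) with h0 | h0
    · refine Or.inr ⟨h0.symm, ih _ ?_⟩
      cases i with
      | zero => exact absurd h0 h
      | succ i => exact ⟨i, by omega, h⟩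
    · exact Or.inl h0

lemma LeW_glue (N : ℕ) (v : List ℕ) : ∀ (p : List ℕ) (w : Seq),
    (∀ q, ∃ i, i < N ∧ w (q + i) ≠ 0) → LeW p w → LeW (p ++ (List.replicate N 0 ++ v)) w := by
  intro p
  induction p with
  | nil =>
    intro w hw _
    obtain ⟨i, hi, h⟩ := hw 0
    exact LeW_zero_run N v w ⟨i, hi, by simpa using h⟩
  | cons a p ih =>
    intro w hw h
    rcases h with h | ⟨h, h'⟩
    · exact Or.inl h
    · refine Or.inr ⟨h, ih _ (fun q => ?_) h'⟩
      obtain ⟨i, hi, h⟩ := hw (q + 1)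
      exact ⟨i, hi, by unfold shift; rw [show q + i + 1 = q + 1 + i by omega]; exact h⟩

def Glue (w : Seq) (N : ℕ) : Prop := ∀ u v, Adm w u → Adm w v → Adm w (u ++ (List.replicate N 0 ++ v))

lemma Sseq_glue {k : ℕ} (hk : 2 ≤ k) (n : ℕ → ℕ) : Glue (Sseq k n) (n 0 + 3) := by
  intro u v hu hv
  have h0 : 0 < Sseq k n 0 := by rw [Sseq_zero hk]; omega
  refine Adm_context (y := []) (Adm_zeros h0 hv _) ?_ u (by simpa using hu)
  intro p hp
  refine LeW_glue _ v p _ (fun q => ?_) (by simpa using hp)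
  rw [Sseq_eq hk]
  exact lamSub_run hk _ q _

lemma Adm_lt {k : ℕ} (hk : 2 ≤ k) {w : Seq} (hw : w 0 = k - 1) {u : List ℕ} (h : Adm w u) :
    ∀ a ∈ u, a < k := by
  induction u with
  | nil => simp
  | cons b u ih =>
    intro a ha
    rcases List.mem_cons.1 ha with rfl | ha
    · rcases h.1 with h | ⟨h, _⟩ <;> omega
    · exact ih h.2 a ha

def Ac {k : ℕ} (w : Seq) (c : E k) : Prop := ∀ ε : ℝ, 0 < ε → ∃ L0 : ℕ, ∀ L : ℕ, L0 ≤ L →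
  ∃ u, Adm w u ∧ ∀ i, i < k → |proj (cvec k u) i - L * proj c i| ≤ ε * L

lemma exists_large (C ε : ℝ) (hε : 0 < ε) : ∃ L0 : ℕ, ∀ L : ℕ, L0 ≤ L → C ≤ ε * L := by
  obtain ⟨L0, h⟩ := exists_nat_gt (C / ε)
  refine ⟨L0, fun L hL => ?_⟩
  have h1 : (L0 : ℝ) ≤ L := by exact_mod_cast hL
  have h2 : C < L0 * ε := (div_lt_iff₀ hε).1 h
  nlinarith

lemma Ac_add {k : ℕ} {w : Seq} {N : ℕ} (hN : Glue w N) {c d : E k} (hc : Ac w c) (hd : Ac w d) :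
    Ac w (c + d) := by
  intro ε hε
  obtain ⟨L1, h1⟩ := hc (ε / 3) (by linarith)
  obtain ⟨L2, h2⟩ := hd (ε / 3) (by linarith)
  obtain ⟨L3, h3⟩ := exists_large N (ε / 3) (by linarith)
  refine ⟨L1 + L2 + L3, fun L hL => ?_⟩
  obtain ⟨u, hu, hu'⟩ := h1 L (by omega)
  obtain ⟨v, hv, hv'⟩ := h2 L (by omega)
  refine ⟨_, hN u v hu hv, fun i hi => ?_⟩
  have a1 := abs_le.1 (hu' i hi)
  have a2 := abs_le.1 (hv' i hi)
  have a3 := h3 L (by omega)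
  rw [cvec_append, cvec_append, proj_add, proj_add, proj_add]
  have a4 := NN0_cvec (k := k) (List.replicate N 0) i hi
  have a5 := ((NN0_cvec (k := k) (List.replicate N 0)).le_vsum hi).trans (vsum_cvec_le _)
  rw [List.length_replicate] at a5
  rw [abs_le]
  constructor <;> nlinarith

lemma cvec_rep {k : ℕ} (x : List ℕ) (j : ℕ) :
    cvec k (List.replicate j x).flatten = (j : ℝ) • cvec k x := by
  induction j with
  | zero => simp [cvec_nil]
  | succ j ih =>
    rw [List.replicate_succ, List.flatten_cons, cvec_append, ih]
    push_cast
    rw [add_smul, one_smul, add_comm]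

lemma Ac_rep {k : ℕ} {w : Seq} {x : List ℕ} (hx : ∀ j, Adm w (List.replicate j x).flatten)
    {t : ℝ} (ht : 0 ≤ t) : Ac w (t • cvec k x) := by
  intro ε hε
  obtain ⟨L0, h0⟩ := exists_large x.length ε hε
  refine ⟨L0, fun L hL => ⟨_, hx ⌊t * L⌋₊, fun i hi => ?_⟩⟩
  rw [cvec_rep, proj_smul, proj_smul]
  have a1 := h0 L hL
  have a2 := NN0_cvec (k := k) x i hi
  have a3 := ((NN0_cvec (k := k) x).le_vsum hi).trans (vsum_cvec_le _)
  have hp : 0 ≤ t * L := by positivity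
  have a4 := Nat.floor_le hp
  have a5 := Nat.lt_floor_add_one (t * L)
  rw [abs_le]
  constructor <;> nlinarith

lemma Ac_closed {k : ℕ} {w : Seq} {c : E k}
    (h : ∀ δ : ℝ, 0 < δ → ∃ d : E k, Ac w d ∧ ∀ i, i < k → |proj c i - proj d i| ≤ δ) : Ac w c := by
  intro ε hε
  obtain ⟨d, hd, hcd⟩ := h (ε / 2) (by linarith)
  obtain ⟨L0, h0⟩ := hd (ε / 2) (by linarith)
  refine ⟨L0, fun L hL => ?_⟩
  obtain ⟨u, hu, hu'⟩ := h0 L hL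
  refine ⟨u, hu, fun i hi => ?_⟩
  have a1 := abs_le.1 (hu' i hi)
  have a2 := abs_le.1 (hcd i hi)
  have a3 : (0 : ℝ) ≤ L := by positivity
  have a4 := mul_le_mul_of_nonneg_right a2.1 a3
  have a5 := mul_le_mul_of_nonneg_right a2.2 a3
  rw [abs_le]
  constructor <;> nlinarith

lemma Ac_Mv {k : ℕ} (hk : 2 ≤ k) (m : ℕ) {w : Seq} (hw : ∀ r, w r < k) (h0 : w 0 = k - 1) {c : E k}
    (hc : Ac w c) : Ac (lamSub k m w) (Mv m c) := by
  intro ε hε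
  have hm : (0 : ℝ) ≤ m := by positivity
  obtain ⟨L0, hL0⟩ := hc (ε / (2 * m + 2)) (by positivity)
  refine ⟨L0, fun L hL => ?_⟩
  obtain ⟨u, hu, hu'⟩ := hL0 L hL
  refine ⟨_, Adm_lam hk m hw h0 hu, fun i hi => ?_⟩
  rw [cvec_lamL hk m u (Adm_lt hk h0 hu)]
  set η := ε / (2 * m + 2) * L with hη
  have hη0 : 0 ≤ η := by positivity
  have e : ε * L = (2 * m + 2) * η := by rw [hη]; field_simp
  have a1 := abs_le.1 (hu' (k - 2) (by omega))
  have a2 := abs_le.1 (hu' (k - 1) (by omega))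
  have a3 := abs_le.1 (hu' (i - 1) (by omega))
  rw [proj_Mv _ _ _ hi, proj_Mv _ _ _ hi, e, abs_le]
  split_ifs
  · constructor <;> nlinarith
  · constructor <;> nlinarith
  · constructor <;> nlinarith

lemma Ac_low {k : ℕ} (hk : 2 ≤ k) (m a : ℕ) (ha : a < k - 1) {w : Seq} (h0 : w 0 = k - 1)
    {t : ℝ} (ht : 0 ≤ t) : Ac (lamSub k m w) (Mv m (t • evec k a)) := by
  rw [Mv_smul, ← cvec_lamWord hk m a (by omega)]
  refine Ac_rep (fun j => ?_) ht
  have := Adm_low hk m h0 (r := []) trivial (List.replicate j a) (by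
    intro y hy; rw [List.eq_of_mem_replicate hy]; exact ha)
  simpa [lamL, List.flatMap] using this

lemma Ac_zero {k : ℕ} {w : Seq} : Ac w (0 : E k) := by
  intro ε hε
  refine ⟨0, fun L _ => ⟨[], trivial, fun i _ => ?_⟩⟩
  rw [cvec_nil, proj_zero]; simp; positivity

lemma Ac_TT {k : ℕ} (hk : 2 ≤ k) (n : ℕ → ℕ) {c : E k} (h : NN0 c) (hT : TT (n 0) c) :
    Ac (Sseq k n) c := by
  set m := n 0 with hm
  have hg := Sseq_glue hk n
  have hS := Sseq_eq hk n
  have h0 := Sseq_zero hk (sh n)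
  have key : ∀ j, j ≤ k - 1 → ∃ b : E k, (∀ i, i < k → proj b i = if i < j then proj c (i + 1) else 0) ∧
      Ac (Sseq k n) (Mv m b) := by
    intro j
    induction j with
    | zero =>
      intro _
      refine ⟨0, fun i _ => by simp [proj_zero], ?_⟩
      have : Mv m (0 : E k) = 0 := by simpa using Mv_smul m (0 : ℝ) (0 : E k)
      rw [this]; exact Ac_zero
    | succ j ih =>
      intro hj
      obtain ⟨b, hb, hA⟩ := ih (by omega)
      refine ⟨b + proj c (j + 1) • evec k j, fun i hi => ?_, ?_⟩
      · rw [proj_add, proj_smul, hb i hi, proj_evec _ _ hi]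
        rcases lt_trichotomy i j with h1 | h1 | h1
        · rw [if_pos h1, if_neg (by omega), if_pos (by omega)]; ring
        · subst h1; simp
        · rw [if_neg (by omega), if_neg (by omega), if_neg (by omega)]; ring
      · rw [Mv_add]
        refine Ac_add hg hA ?_
        rw [hS]
        exact Ac_low hk m j (by omega) h0 (h _ (by omega))
  obtain ⟨b, hb, hA⟩ := key (k - 1) le_rfl
  have e : c = Mv m b + (proj c 0 - (m + 1) * proj c (k - 1)) • cvec k [0] := by
    apply proj_ext; intro i hi
    rw [proj_add, proj_Mv _ _ _ hi, proj_smul, cvec_single, proj_evec _ _ hi, hb (k - 2) (by omega),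
      hb (k - 1) (by omega), hb (i - 1) (by omega), if_pos (by omega : k - 2 < k - 1), if_neg (by omega : ¬ k - 1 < k - 1),
      if_pos (by omega : i - 1 < k - 1), show k - 2 + 1 = k - 1 by omega]
    by_cases hi0 : i = 0
    · subst hi0; simp
    · by_cases hi1 : i + 1 = k
      · have : k - 1 = i := by omega
        simp [hi0, hi1, this]
      · simp [hi0, hi1, show i - 1 + 1 = i by omega]
  rw [e]
  refine Ac_add hg hA (Ac_rep (fun j => ?_) (by unfold TT at hT; linarith))
  have hpos : 0 < Sseq k n 0 := by rw [Sseq_zero hk]; omega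
  have := Adm_zeros hpos (z := []) trivial j
  have e2 : (List.replicate j [0]).flatten = List.replicate j 0 := by
    clear this
    induction j with
    | zero => rfl
    | succ j ih => rw [List.replicate_succ, List.flatten_cons, ih]; rfl
  rw [e2]; simpa using this

lemma Ac_Lo {k : ℕ} (hk : 2 ≤ k) (r : ℕ) : ∀ (n : ℕ → ℕ) (c : E k), Lo r n c → Ac (Sseq k n) c := by
  induction r with
  | zero => rintro n c ⟨h1, h2⟩; exact Ac_TT hk n h1 h2
  | succ r ih =>
    rintro n c ⟨h1, h2 | h2⟩
    · exact Ac_TT hk n h1 h2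
    · have := Ac_Mv hk (n 0) (Sseq_lt hk _) (Sseq_zero hk _) (ih _ _ h2)
      rw [Mv_Mi hk, ← Sseq_eq hk] at this
      exact this

lemma Ac_GG {k : ℕ} (hk : 2 ≤ k) {n : ℕ → ℕ} {c : E k} (h : GG n c) : Ac (Sseq k n) c := by
  rcases GG_cases h with ⟨r, hr⟩ | hF
  · exact Ac_Lo hk r n c hr
  · refine Ac_closed fun δ hδ => ?_
    obtain ⟨d, ⟨r, hr⟩, hd⟩ := Fib_approx hk hF δ hδ
    exact ⟨d, Ac_Lo hk r n d hr, hd⟩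

/-! ### Building a sequence with prescribed frequencies -/

lemma vsum_cvec_eq {k : ℕ} (l : List ℕ) (hl : ∀ a ∈ l, a < k) : vsum (cvec k l) = l.length := by
  induction l with
  | nil => rw [cvec_nil, vsum_zero]; simp
  | cons a l ih =>
    rw [cvec_cons, vsum_add, cvec_single, vsum_evec a (hl a (by simp)),
      ih fun b hb => hl b (by simp [hb])]
    push_cast [List.length_cons]
    ring

noncomputable def err {k : ℕ} (α : E k) (u : List ℕ) : ℝ :=
  ∑ i ∈ Finset.range k, |proj (cvec k u) i - u.length * proj α i|

lemma err_nonneg {k : ℕ} (α : E k) (u : List ℕ) : 0 ≤ err α u :=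
  Finset.sum_nonneg fun _ _ => abs_nonneg _

lemma Ac_exact {k : ℕ} (hk : 2 ≤ k) {w : Seq} (h0 : w 0 = k - 1) {α : E k} (hα : α ∈ simplex k)
    (hA : Ac w α) : ∀ ε : ℝ, 0 < ε → ∃ L0 : ℕ, ∀ L : ℕ, L0 ≤ L →
    ∃ u, Adm w u ∧ u.length = L ∧ err α u ≤ ε * L := by
  intro ε hε
  have hk0 : (0 : ℝ) < k := by have : 0 < k := by omega
                               exact_mod_cast this
  have hα1 := ((mem_simplex α).1 hα).2
  obtain ⟨L0, hL0⟩ := hA (ε / (k * (k + 1))) (by positivity)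
  refine ⟨L0, fun L hL => ?_⟩
  obtain ⟨u, hu, hu'⟩ := hL0 L hL
  set η := ε / (k * (k + 1)) * L with hη
  have hlen : |(u.length : ℝ) - L| ≤ k * η := by
    rw [← vsum_cvec_eq u (Adm_lt hk h0 hu)]
    have e : vsum (cvec k u) - L = ∑ i ∈ Finset.range k, (proj (cvec k u) i - L * proj α i) := by
      rw [Finset.sum_sub_distrib, ← Finset.mul_sum]
      have : ∑ i ∈ Finset.range k, proj α i = 1 := hα1
      rw [this, mul_one]; rfl
    rw [e]
    refine (Finset.abs_sum_le_sum_abs _ _).trans ?_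
    refine (Finset.sum_le_sum fun i hi => hu' i (Finset.mem_range.1 hi)).trans ?_
    simp
  set v := (u ++ List.replicate L 0).take L with hv
  have hvl : v.length = L := by rw [hv]; simp
  have hvA : Adm w v := by
    have := Adm_pad (w := w) (by omega) L hu
    rw [← List.take_append_drop L (u ++ List.replicate L 0)] at this
    exact Adm_prefix this
  have hcnt : ∀ i, i < k → |proj (cvec k v) i - proj (cvec k u) i| ≤ |(u.length : ℝ) - L| := by
    intro i hi
    rcases le_total u.length L with h | h
    · have : v = u ++ List.replicate (L - u.length) 0 := by
        rw [hv, List.take_append, List.take_of_length_le h]; simp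
      rw [this, cvec_append, proj_add, add_sub_cancel_left, abs_of_nonneg (NN0_cvec _ i hi),
        abs_sub_comm]
      refine ((NN0_cvec _).le_vsum hi).trans ((vsum_cvec_le _).trans ?_)
      rw [List.length_replicate, Nat.cast_sub h]
      exact le_abs_self _
    · have : v = u.take L := by
        rw [hv, List.take_append_of_le_length h]
      rw [this]
      have e : cvec k u = cvec k (u.take L) + cvec k (u.drop L) := by
        rw [← cvec_append, List.take_append_drop]
      rw [e, proj_add, sub_add_cancel_left, abs_neg, abs_of_nonneg (NN0_cvec _ i hi)]
      refine ((NN0_cvec _).le_vsum hi).trans ((vsum_cvec_le _).trans ?_)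
      rw [List.length_drop, Nat.cast_sub h]
      exact le_abs_self _
  refine ⟨v, hvA, hvl, ?_⟩
  have e : ε * L = ∑ i ∈ Finset.range k, (k + 1) * η := by
    rw [Finset.sum_const, Finset.card_range, nsmul_eq_mul, hη]
    field_simp
  rw [e]
  refine Finset.sum_le_sum fun i hi => ?_
  have hi := Finset.mem_range.1 hi
  have a1 := hu' i hi
  have a2 := (hcnt i hi).trans hlen
  rw [hvl]
  have := abs_add_le (proj (cvec k v) i - proj (cvec k u) i) (proj (cvec k u) i - L * proj α i)
  rw [sub_add_sub_cancel] at this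
  linarith

lemma exists_best {k : ℕ} {w : Seq} (h0 : 0 < w 0) (α : E k) (j : ℕ) :
    ∃ u, (Adm w u ∧ u.length = j) ∧ ∀ u', Adm w u' → u'.length = j → err α u ≤ err α u' + 1 := by
  set s : Set ℝ := {x | ∃ u, Adm w u ∧ u.length = j ∧ err α u = x} with hs
  have hne : s.Nonempty := ⟨_, List.replicate j 0, by
    have := Adm_zeros (w := w) h0 (z := []) trivial j
    simpa using this, by simp, rfl⟩
  have hb : BddBelow s := ⟨0, by rintro x ⟨u, _, _, rfl⟩; exact err_nonneg _ _⟩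
  obtain ⟨x, ⟨u, h1, h2, rfl⟩, h3⟩ := exists_lt_of_csInf_lt hne (lt_add_one (sInf s))
  refine ⟨u, ⟨h1, h2⟩, fun u' h1' h2' => ?_⟩
  have := csInf_le hb (⟨u', h1', h2', rfl⟩ : err α u' ∈ s)
  linarith

lemma exists_blocks {k : ℕ} (hk : 2 ≤ k) {w : Seq} (h0 : w 0 = k - 1) {α : E k} (hα : α ∈ simplex k)
    (hA : Ac w α) : ∃ u : ℕ → List ℕ, (∀ j, Adm w (u j)) ∧ (∀ j, (u j).length = j) ∧
    ∀ ε : ℝ, 0 < ε → ∃ J0 : ℕ, ∀ j, J0 ≤ j → err α (u j) ≤ ε * j := by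
  choose u hu hu' using exists_best (w := w) (by omega) α
  refine ⟨u, fun j => (hu j).1, fun j => (hu j).2, fun ε hε => ?_⟩
  obtain ⟨L0, h1⟩ := Ac_exact hk h0 hα hA (ε / 2) (by linarith)
  obtain ⟨L1, h2⟩ := exists_large 1 (ε / 2) (by linarith)
  refine ⟨L0 + L1, fun j hj => ?_⟩
  obtain ⟨v, k1, k2, k3⟩ := h1 j (by omega)
  have := hu' j v k1 k2
  have := h2 j (by omega)
  linarith

noncomputable def dev {k : ℕ} (α : E k) (i : ℕ) (l : List ℕ) : ℝ :=
  proj (cvec k l) i - l.length * proj α i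

lemma dev_append {k : ℕ} (α : E k) (i : ℕ) (l t : List ℕ) :
    dev α i (l ++ t) = dev α i l + dev α i t := by
  unfold dev
  rw [cvec_append, proj_add, List.length_append]; push_cast; ring

lemma dev_le {k : ℕ} {α : E k} (hα : α ∈ simplex k) {i : ℕ} (hi : i < k) (l : List ℕ) :
    |dev α i l| ≤ l.length := by
  obtain ⟨h1, h2⟩ := (mem_simplex α).1 hα
  have a1 := h1 i hi
  have a2 := h1.le_vsum hi
  rw [h2] at a2
  have a3 := NN0_cvec (k := k) l i hi
  have a4 := ((NN0_cvec (k := k) l).le_vsum hi).trans (vsum_cvec_le l)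
  have a5 : (0 : ℝ) ≤ l.length := by positivity
  unfold dev
  rw [abs_le]
  constructor <;> nlinarith

lemma dev_le_err {k : ℕ} (α : E k) {i : ℕ} (hi : i < k) (l : List ℕ) : |dev α i l| ≤ err α l :=
  Finset.single_le_sum (f := fun i => |proj (cvec k l) i - l.length * proj α i|)
    (fun _ _ => abs_nonneg _) (Finset.mem_range.2 hi)

lemma fl_mono (b : ℕ → List ℕ) : Monotone fun J => (fl b J).length :=
  monotone_nat_of_le_succ fun J => by rw [fl_succ, List.length_append]; omega

lemma exists_bracket (b : ℕ → List ℕ) (hb : ∀ r, b r ≠ []) (r : ℕ) :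
    ∃ J, (fl b J).length ≤ r ∧ r < (fl b (J + 1)).length := by
  have hex : ∃ J, r < (fl b (J + 1)).length := ⟨r, fl_length b hb (r + 1)⟩
  refine ⟨Nat.find hex, ?_, Nat.find_spec hex⟩
  rcases Nat.eq_zero_or_pos (Nat.find hex) with h | h
  · rw [h]; simp [fl]
  · have := Nat.find_min hex (Nat.sub_one_lt h.ne')
    rw [Nat.sub_add_cancel h] at this
    omega

lemma DFn_sup {k : ℕ} (hk : 2 ≤ k) (n : ℕ → ℕ) {α : E k} (hα : α ∈ simplex k) (hG : GG n α) :
    α ∈ DFn k n := by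
  have h0 := Sseq_zero hk n
  have hg := Sseq_glue hk n
  obtain ⟨u, hu1, hu2, hu3⟩ := exists_blocks hk h0 hα (Ac_GG hk hG)
  set N := n 0 + 3 with hN
  set b : ℕ → List ℕ := fun j => List.replicate N 0 ++ u j with hb
  have hbl : ∀ j, (b j).length = N + j := fun j => by rw [hb]; simp [hu2]
  have hbne : ∀ j, b j ≠ [] := fun j e => by
    have := hbl j
    rw [e] at this; simp at this; omega
  have hflA : ∀ J, Adm (Sseq k n) (fl b J) := by
    intro J
    induction J with
    | zero => simp [fl]; trivial
    | succ J ih => rw [fl_succ]; exact hg _ _ ih (hu1 J)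
  have hpre : ∀ J s, pre (flatSeq b) ((fl b J).length + s) =
      fl b J ++ pre (flatSeq fun r => b (r + J)) s := by
    intro J s
    conv_lhs => rw [flatSeq_app_fl J b hbne]
    rw [pre_app]
  have hA : ∀ r, Adm (Sseq k n) (pre (flatSeq b) r) := by
    intro r
    have h1 := hpre r 0
    obtain ⟨d, hd⟩ := Nat.exists_eq_add_of_le (fl_length b hbne r)
    have h2 := hflA r
    rw [add_zero] at h1
    simp only [pre, List.append_nil] at h1
    rw [← h1, hd, pre_add] at h2
    exact Adm_prefix h2
  refine ⟨hα, flatSeq b, (mem_Xset hk h0).2 hA, ?_⟩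
  intro i hi
  have hquad : ∀ J : ℕ, (J : ℝ) * (J - 1) / 2 ≤ (fl b J).length := by
    intro J
    induction J with
    | zero => simp
    | succ J ih =>
      rw [fl_succ, List.length_append, hbl]
      push_cast
      have : (0 : ℝ) ≤ N := by positivity
      nlinarith
  have hbound : ∀ ε : ℝ, 0 < ε → ∃ C : ℝ, ∀ r : ℕ, |dev α i (pre (flatSeq b) r)| ≤ ε * r + C := by
    intro ε hε
    obtain ⟨J0, hJ0⟩ := hu3 (ε / 4) (by linarith)
    obtain ⟨J2, hJ2⟩ := exists_large N (ε / 4) (by linarith)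
    obtain ⟨J1, hJ1⟩ := exists_nat_gt (4 / ε)
    set Q := J0 + J2 with hQ
    have hfl : ∀ J, |dev α i (fl b J)| ≤ ε / 2 * (fl b J).length + (fl b Q).length := by
      intro J
      rcases le_total J Q with h | h
      · have h1 := dev_le hα hi (fl b J)
        have h2 : ((fl b J).length : ℝ) ≤ (fl b Q).length := by exact_mod_cast fl_mono b h
        have : (0 : ℝ) ≤ ε / 2 * (fl b J).length := by positivity
        linarith
      · induction J, h using Nat.le_induction with
        | base =>
          have h1 := dev_le hα hi (fl b Q)
          have : (0 : ℝ) ≤ ε / 2 * (fl b Q).length := by positivity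
          linarith
        | succ J hJ ih =>
          rw [fl_succ, dev_append, List.length_append, hbl]
          have h1 : |dev α i (b J)| ≤ N + err α (u J) := by
            show |dev α i (List.replicate N 0 ++ u J)| ≤ _
            rw [dev_append]
            refine (abs_add_le _ _).trans (add_le_add ?_ (dev_le_err α hi _))
            have := dev_le hα hi (List.replicate N 0)
            simpa using this
          have h2 := hJ0 J (by omega)
          have h3 := hJ2 J (by omega)
          have h4 := abs_add_le (dev α i (fl b J)) (dev α i (b J))
          have h5 : (0 : ℝ) ≤ ε / 2 * N := by positivity
          push_cast
          linarith
    refine ⟨(fl b Q).length + N + J1 + 1, fun r => ?_⟩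
    obtain ⟨J, hJ, hJ'⟩ := exists_bracket b hbne r
    obtain ⟨d, rfl⟩ := Nat.exists_eq_add_of_le hJ
    rw [hpre, dev_append]
    rw [fl_succ, List.length_append, hbl] at hJ'
    have hd : (d : ℝ) ≤ N + J := by
      have : d ≤ N + J := by omega
      exact_mod_cast this
    have h1 := hfl J
    have h2 := dev_le hα hi (pre (flatSeq fun r => b (r + J)) d)
    rw [pre_length] at h2
    have h3 := abs_add_le (dev α i (fl b J)) (dev α i (pre (flatSeq fun r => b (r + J)) d))
    have h4 : (J : ℝ) ≤ ε / 2 * (fl b J).length + (J1 + 1) := by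
      have hlen : (0 : ℝ) ≤ (fl b J).length := by positivity
      rcases le_total (J : ℝ) (J1 + 1) with h | h
      · have : 0 ≤ ε / 2 * ((fl b J).length : ℝ) := by positivity
        linarith
      · have h6 : 4 < J1 * ε := (div_lt_iff₀ hε).1 hJ1
        have h7 := hquad J
        have h8 : 4 ≤ ε * ((J : ℝ) - 1) := by nlinarith
        have h9 : (0 : ℝ) ≤ J := by positivity
        have h10 : ε / 2 * ((J : ℝ) * (J - 1) / 2) ≤ ε / 2 * (fl b J).length :=
          mul_le_mul_of_nonneg_left h7 (by linarith)
        have h11 : (0 : ℝ) ≤ J1 := by positivity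
        nlinarith [mul_le_mul_of_nonneg_left h8 h9]
    have h5 : 0 ≤ ε * (d : ℝ) := by positivity
    push_cast
    nlinarith
  rw [Metric.tendsto_atTop]
  intro ε hε
  obtain ⟨C, hC⟩ := hbound (ε / 3) (by linarith)
  obtain ⟨L0, hL0⟩ := exists_large C (ε / 3) (by linarith)
  refine ⟨L0 + 1, fun r hr => ?_⟩
  have hr0 : (0 : ℝ) < r := by
    have : 0 < r := by omega
    exact_mod_cast this
  have h1 := hC r
  have h2 := hL0 r (by omega)
  unfold dev at h1
  rw [pre_length, proj_cvec _ _ hi, ← digitCount_eq] at h1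
  rw [Real.dist_eq]
  have e : (digitCount (flatSeq b) i r : ℝ) / r - proj α i =
      ((digitCount (flatSeq b) i r : ℝ) - r * proj α i) / r := by field_simp
  rw [e, abs_div, abs_of_pos hr0, div_lt_iff₀ hr0]
  nlinarith

lemma DF_eq {k : ℕ} (hk : 2 ≤ k) (n : ℕ → ℕ) :
    DFn k n = {α : E k | α ∈ simplex k ∧ GG n α} := by
  ext α
  exact ⟨fun h => DFn_sub hk n h, fun h => DFn_sup hk n h.1 h.2⟩

/-- `FE(n) ⊆ E(n) ⊆ FE(n) ∪ Ext(Φ^{-1}(n))`. -/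
theorem stmt6 (k : ℕ) (hk : 2 ≤ k) (n : ℕ → ℕ) :
    FEset k n ⊆ Eset k n ∧
    Eset k n ⊆ FEset k n ∪ Set.extremePoints ℝ (PhiFiber k n) := by
  exact final hk n (DF_eq hk n)

end BetaDF
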